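/- Let P be a d-dimensional polytope with exactly d+4 vertices. Then xc(P) = d+2 if and only if P has exactly d+2 facets, which holds if and only if P is combinatorially equivalent to the (d−4)-fold pyramid over the product Δ_1 × Δ_3. -/

import Mathlib

open Set

noncomputable section

/-- A polytope: the convex hull of a finite set of points. -/
def IsPolytope {N : ℕ} (P : Set (Fin N → ℝ)) : Prop :=
  ∃ S : Finset (Fin N → ℝ), P = convexHull ℝ (S : Set (Fin N → ℝ))

/-- Dimension of a set: the dimension of its affine hull (with `-1` for the empty set). -/
def pdim {N : ℕ} (P : Set (Fin N → ℝ)) : ℤ :=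
  haveI := Classical.dec P.Nonempty
  if P.Nonempty then (Module.finrank ℝ (affineSpan ℝ P).direction : ℤ) else -1

/-- `F` is a face of `P`: the subset of `P` where some linear functional bounded above on `P`
attains its maximum value.  This includes `∅` and `P` itself. -/
def IsFaceOf {N : ℕ} (F P : Set (Fin N → ℝ)) : Prop :=
  ∃ (c : Fin N → ℝ) (b : ℝ),
    (∀ x ∈ P, ∑ i, c i * x i ≤ b) ∧ F = {x ∈ P | ∑ i, c i * x i = b}

/-- A facet: a face of dimension one less than the polytope. -/
def IsFacetOf {N : ℕ} (F P : Set (Fin N → ℝ)) : Prop :=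
  IsFaceOf F P ∧ pdim F + 1 = pdim P

/-- A ridge: a face of dimension two less than the polytope. -/
def IsRidgeOf {N : ℕ} (F P : Set (Fin N → ℝ)) : Prop :=
  IsFaceOf F P ∧ pdim F + 2 = pdim P

def IsVertexOf {N : ℕ} (v : Fin N → ℝ) (P : Set (Fin N → ℝ)) : Prop :=
  IsFaceOf {v} P

def vertexSet {N : ℕ} (P : Set (Fin N → ℝ)) : Set (Fin N → ℝ) :=
  {v | IsVertexOf v P}

def vertexCount {N : ℕ} (P : Set (Fin N → ℝ)) : ℕ := (vertexSet P).ncard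

def facetCount {N : ℕ} (P : Set (Fin N → ℝ)) : ℕ := {F | IsFacetOf F P}.ncard

/-- Extension complexity: the minimal number of facets of a polytope (in any dimension)
admitting an affine projection onto `P`. -/
def xc {N : ℕ} (P : Set (Fin N → ℝ)) : ℕ :=
  sInf {n | ∃ (e : ℕ) (Q : Set (Fin e → ℝ)) (π : (Fin e → ℝ) →ᵃ[ℝ] (Fin N → ℝ)),
    IsPolytope Q ∧ π '' Q = P ∧ facetCount Q = n}

/-- Combinatorial equivalence: an inclusion-preserving bijection between face lattices. -/
def CombEquiv {M N : ℕ} (P : Set (Fin M → ℝ)) (Q : Set (Fin N → ℝ)) : Prop :=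
  ∃ φ : {F : Set (Fin M → ℝ) // IsFaceOf F P} ≃ {G : Set (Fin N → ℝ) // IsFaceOf G Q},
    ∀ F₁ F₂ : {F : Set (Fin M → ℝ) // IsFaceOf F P},
      F₁.1 ⊆ F₂.1 ↔ (φ F₁).1 ⊆ (φ F₂).1

/-- A full-dimensional `n`-simplex in `ℝ^n` with the origin in its (relative) interior. -/
def simplexF (n : ℕ) : Set (Fin n → ℝ) :=
  convexHull ℝ ((Set.range fun i : Fin n => Pi.single i (1 : ℝ)) ∪ {fun _ => -1})

/-- The Cartesian product `Δ_n × Δ_m`, realized in `ℝ^{n+m}`. -/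
def prodP (n m : ℕ) : Set (Fin (n + m) → ℝ) :=
  {z | ∃ a ∈ simplexF n, ∃ b ∈ simplexF m, z = Fin.append a b}

/-- The direct sum `Δ_n ⊕ Δ_m`, realized in `ℝ^{n+m}`. -/
def sumP (n m : ℕ) : Set (Fin (n + m) → ℝ) :=
  convexHull ℝ (((fun a : Fin n → ℝ => Fin.append a (0 : Fin m → ℝ)) '' simplexF n) ∪
    ((fun b : Fin m → ℝ => Fin.append (0 : Fin n → ℝ) b) '' simplexF m))

/-- The join `A ⋆ B` of two polytopes, realized in `ℝ^{p+q+1}` with the two copies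
placed in skew affine subspaces. -/
def joinP {p q : ℕ} (A : Set (Fin p → ℝ)) (B : Set (Fin q → ℝ)) :
    Set (Fin (p + q + 1) → ℝ) :=
  convexHull ℝ
    (((fun a : Fin p → ℝ =>
        Fin.append (Fin.append a (0 : Fin q → ℝ)) (fun _ : Fin 1 => (0 : ℝ))) '' A) ∪
     ((fun b : Fin q → ℝ =>
        Fin.append (Fin.append (0 : Fin p → ℝ) b) (fun _ : Fin 1 => (1 : ℝ))) '' B))

/-- The canonical `k`-fold iterated pyramid over `X`, realized in `ℝ^{p+k}`. -/
def pyrK {p : ℕ} (k : ℕ) (X : Set (Fin p → ℝ)) : Set (Fin (p + k) → ℝ) :=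
  convexHull ℝ (((fun x : Fin p → ℝ => Fin.append x (0 : Fin k → ℝ)) '' X) ∪
    Set.range (fun j : Fin k => Fin.append (0 : Fin p → ℝ) (Pi.single j (1 : ℝ))))

/-- Transport a subset of `ℝ^a` to `ℝ^b` along a proof that `a = b`. -/
def castSet {a b : ℕ} (h : a = b) (X : Set (Fin a → ℝ)) : Set (Fin b → ℝ) :=
  (fun x : Fin a → ℝ => fun i : Fin b => x (Fin.cast h.symm i)) '' X

/-- Projective equivalence of two subsets of `ℝ^N`: `Q` is the image of `P` under a
projective transformation `x ↦ (A x + b) / (⟨c, x⟩ + δ)` whose associated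
`(N+1) × (N+1)` matrix is invertible and whose denominator is positive on `P`. -/
def ProjEquiv {N : ℕ} (P Q : Set (Fin N → ℝ)) : Prop :=
  ∃ (A : (Fin N → ℝ) →ₗ[ℝ] (Fin N → ℝ)) (b c : Fin N → ℝ) (δ : ℝ),
    Function.Bijective
      (fun z : (Fin N → ℝ) × ℝ => (A z.1 + z.2 • b, (∑ i, c i * z.1 i) + δ * z.2)) ∧
    (∀ x ∈ P, 0 < (∑ i, c i * x i) + δ) ∧
    Q = (fun x : Fin N → ℝ => ((∑ i, c i * x i) + δ)⁻¹ • (A x + b)) '' P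

/-- `P` is a pyramid with base `B`: the convex hull of `B` and a point outside
the affine hull of `B`. -/
def IsPyramidOver {N : ℕ} (P B : Set (Fin N → ℝ)) : Prop :=
  ∃ a : Fin N → ℝ, a ∉ affineSpan ℝ B ∧ P = convexHull ℝ (B ∪ {a})

/-- `P` is a `k`-fold iterated pyramid over `B`. -/
def IsKFoldPyramidOver {N : ℕ} : ℕ → Set (Fin N → ℝ) → Set (Fin N → ℝ) → Prop
  | 0, P, B => P = B
  | k + 1, P, B => ∃ P' : Set (Fin N → ℝ), IsPyramidOver P P' ∧ IsKFoldPyramidOver k P' B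

/-- `P` is a pyramid: the convex hull of one of its facets together with one more vertex. -/
def IsPyramidPolytope {N : ℕ} (P : Set (Fin N → ℝ)) : Prop :=
  ∃ (F : Set (Fin N → ℝ)) (v : Fin N → ℝ),
    IsFacetOf F P ∧ IsVertexOf v P ∧ P = convexHull ℝ (F ∪ {v})

/-- A facet is pyramidal if it contains all vertices of the polytope but one. -/
def IsPyramidalFacet {N : ℕ} (F P : Set (Fin N → ℝ)) : Prop :=
  IsFacetOf F P ∧ ∃ v, IsVertexOf v P ∧ v ∉ F ∧ ∀ w, IsVertexOf w P → w ≠ v → w ∈ F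

/-- The projection `π_d : ℝ^{d+1} → ℝ^d` forgetting the last coordinate. -/
def projFun (d : ℕ) : (Fin (d + 1) → ℝ) → (Fin d → ℝ) :=
  fun x i => x i.castSucc

/-- `c` is an outer normal vector exposing the face `F` of `Q`. -/
def IsOuterNormal {N : ℕ} (Q F : Set (Fin N → ℝ)) (c : Fin N → ℝ) : Prop :=
  ∃ b : ℝ, (∀ x ∈ Q, ∑ i, c i * x i ≤ b) ∧ F = {x ∈ Q | ∑ i, c i * x i = b}

/-- An upper facet: outer normal with positive last coordinate. -/
def IsUpperFacet {d : ℕ} (F Q : Set (Fin (d + 1) → ℝ)) : Prop :=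
  IsFacetOf F Q ∧ ∃ c, IsOuterNormal Q F c ∧ 0 < c (Fin.last d)

/-- A lower facet: outer normal with negative last coordinate. -/
def IsLowerFacet {d : ℕ} (F Q : Set (Fin (d + 1) → ℝ)) : Prop :=
  IsFacetOf F Q ∧ ∃ c, IsOuterNormal Q F c ∧ c (Fin.last d) < 0

/-- A vertical facet: every outer normal has vanishing last coordinate. -/
def IsVerticalFacet {d : ℕ} (F Q : Set (Fin (d + 1) → ℝ)) : Prop :=
  IsFacetOf F Q ∧ ∀ c, IsOuterNormal Q F c → c (Fin.last d) = 0

/-- An equatorial ridge: a ridge that is the intersection of an upper and a lower facet. -/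
def IsEquatorialRidge {d : ℕ} (F Q : Set (Fin (d + 1) → ℝ)) : Prop :=
  IsRidgeOf F Q ∧ ∃ F₁ F₂ : Set (Fin (d + 1) → ℝ),
    IsUpperFacet F₁ Q ∧ IsLowerFacet F₂ Q ∧ F = F₁ ∩ F₂

/-- A face `F` of `Q` is preserved under the projection forgetting the last coordinate. -/
def PreservedFace {d : ℕ} (Q F : Set (Fin (d + 1) → ℝ)) : Prop :=
  IsFaceOf (projFun d '' F) (projFun d '' Q) ∧ projFun d ⁻¹' (projFun d '' F) ∩ Q = F

/-- A face `F` of `Q` is strictly preserved: preserved and of the same dimension as its image. -/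
def StrictlyPreservedFace {d : ℕ} (Q F : Set (Fin (d + 1) → ℝ)) : Prop :=
  PreservedFace Q F ∧ pdim (projFun d '' F) = pdim F

/-- A hexagon: a 2-dimensional polytope with exactly 6 vertices. -/
def IsHexagon {N : ℕ} (P : Set (Fin N → ℝ)) : Prop :=
  IsPolytope P ∧ pdim P = 2 ∧ vertexCount P = 6

/-- Three lines are concurrent: they share a common point, or they are pairwise parallel. -/
def ConcurrentLines {N : ℕ} (L₁ L₂ L₃ : AffineSubspace ℝ (Fin N → ℝ)) : Prop :=
  (∃ x, x ∈ L₁ ∧ x ∈ L₂ ∧ x ∈ L₃) ∨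
    (AffineSubspace.Parallel L₁ L₂ ∧ AffineSubspace.Parallel L₂ L₃ ∧
      AffineSubspace.Parallel L₁ L₃)

/-- A cyclic labeling of the vertices of a hexagon: consecutive points are joined by edges. -/
def CyclicLabeling {N : ℕ} (P : Set (Fin N → ℝ)) (p : Fin 6 → (Fin N → ℝ)) : Prop :=
  Function.Injective p ∧ Set.range p = vertexSet P ∧
    ∀ i : Fin 6, IsFaceOf (segment ℝ (p i) (p (i + 1))) P

/-- A Desarguian hexagon. -/
def Desarguian {N : ℕ} (P : Set (Fin N → ℝ)) : Prop :=
  ∃ p : Fin 6 → (Fin N → ℝ), CyclicLabeling P p ∧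
    ConcurrentLines (affineSpan ℝ {p 0, p 1}) (affineSpan ℝ {p 5, p 2})
      (affineSpan ℝ {p 3, p 4})

/-- A polytope is simplicial if every facet is a simplex. -/
def IsSimplicial {N : ℕ} (P : Set (Fin N → ℝ)) : Prop :=
  ∀ F : Set (Fin N → ℝ), IsFacetOf F P →
    ∃ S : Finset (Fin N → ℝ),
      AffineIndependent ℝ (Subtype.val : {x // x ∈ S} → (Fin N → ℝ)) ∧
      F = convexHull ℝ (S : Set (Fin N → ℝ))

/-! ### Affine functionals -/

/-- Coefficients `(c, b)` of the affine functional `x ↦ b - ⟨c, x⟩`. -/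
abbrev AffFun (N : ℕ) : Type := (Fin N → ℝ) × ℝ

/-- The value of the affine functional `e` at `x`. -/
def slack {N : ℕ} (e : AffFun N) (x : Fin N → ℝ) : ℝ := e.2 - ∑ i, e.1 i * x i

section Slack

variable {N : ℕ}

/-- Evaluation at `x` as a linear map on affine functionals. -/
def slackAt (x : Fin N → ℝ) : AffFun N →ₗ[ℝ] ℝ where
  toFun e := slack e x
  map_add' e e' := by
    simp only [slack, Prod.snd_add, Prod.fst_add, Pi.add_apply, add_mul, Finset.sum_add_distrib]
    ring
  map_smul' t e := by
    have h : ∑ i, (t • e).1 i * x i = t * ∑ i, e.1 i * x i := by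
      rw [Finset.mul_sum]
      exact Finset.sum_congr rfl fun i _ => mul_assoc t (e.1 i) (x i)
    have h' : (t • e).2 = t * e.2 := rfl
    simp only [slack, h, h', smul_eq_mul, RingHom.id_apply]
    ring

theorem slack_add (e e' : AffFun N) (x : Fin N → ℝ) :
    slack (e + e') x = slack e x + slack e' x := (slackAt x).map_add e e'

theorem slack_sub (e e' : AffFun N) (x : Fin N → ℝ) :
    slack (e - e') x = slack e x - slack e' x := (slackAt x).map_sub e e'

theorem slack_neg (e : AffFun N) (x : Fin N → ℝ) :
    slack (-e) x = -slack e x := (slackAt x).map_neg e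

theorem slack_smul (t : ℝ) (e : AffFun N) (x : Fin N → ℝ) :
    slack (t • e) x = t * slack e x := (slackAt x).map_smul t e

theorem slack_sum {κ : Type*} (T : Finset κ) (f : κ → AffFun N) (x : Fin N → ℝ) :
    slack (∑ i ∈ T, f i) x = ∑ i ∈ T, slack (f i) x := map_sum (slackAt x) f T

theorem slack_sum_smul {κ : Type*} [Fintype κ] (ρ : κ → ℝ) (f : κ → AffFun N)
    (x : Fin N → ℝ) : slack (∑ i, ρ i • f i) x = ∑ i, ρ i * slack (f i) x := by
  simp only [slack_sum, slack_smul]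

theorem slack_zero_one (x : Fin N → ℝ) : slack ((0, 1) : AffFun N) x = 1 := by
  simp [slack]

theorem slack_combination {ι : Type*} (T : Finset ι) (w : ι → ℝ) (z : ι → Fin N → ℝ)
    (hw : ∑ i ∈ T, w i = 1) (e : AffFun N) :
    slack e (∑ i ∈ T, w i • z i) = ∑ i ∈ T, w i * slack e (z i) := by
  simp only [slack, mul_sub, Finset.sum_sub_distrib, ← Finset.sum_mul, hw, one_mul,
    Finset.sum_apply, Pi.smul_apply, smul_eq_mul, Finset.mul_sum]
  rw [Finset.sum_comm]
  congr 1
  refine Finset.sum_congr rfl fun i _ => Finset.sum_congr rfl fun j _ => by ring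

/-- A point of the convex hull of a finite set evaluates functionals as a convex combination. -/
theorem exists_weights {S : Finset (Fin N → ℝ)} {x : Fin N → ℝ}
    (hx : x ∈ convexHull ℝ (S : Set (Fin N → ℝ))) :
    ∃ w : (Fin N → ℝ) → ℝ, (∀ s ∈ S, 0 ≤ w s) ∧ ∑ s ∈ S, w s = 1 ∧
      ∑ s ∈ S, w s • s = x ∧ ∀ e, slack e x = ∑ s ∈ S, w s * slack e s := by
  obtain ⟨w, hw, hw1, rfl⟩ := Finset.mem_convexHull'.1 hx
  exact ⟨w, hw, hw1, rfl, slack_combination S w id hw1⟩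

theorem convex_slack_nonneg (e : AffFun N) : Convex ℝ {x | 0 ≤ slack e x} := by
  intro x hx y hy a b ha hb hab
  have h : slack e (a • x + b • y) = a * slack e x + b * slack e y := by
    have := slack_combination Finset.univ ![a, b] ![x, y] (by simpa using hab) e
    simpa using this
  simp only [mem_ofPred_eq] at hx hy ⊢
  rw [h]
  positivity

theorem slack_nonneg_of_mem_convexHull {X : Set (Fin N → ℝ)} {e : AffFun N}
    (h : ∀ x ∈ X, 0 ≤ slack e x) : ∀ x ∈ convexHull ℝ X, 0 ≤ slack e x :=
  fun _ hx => convexHull_min h (convex_slack_nonneg e) hx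

theorem slack_eq_zero_of_mem_convexHull {X : Set (Fin N → ℝ)} {e : AffFun N}
    (h : ∀ x ∈ X, slack e x = 0) : ∀ x ∈ convexHull ℝ X, slack e x = 0 := by
  intro x hx
  refine le_antisymm ?_ (slack_nonneg_of_mem_convexHull (fun y hy => (h y hy).ge) x hx)
  have := slack_nonneg_of_mem_convexHull (e := -e)
    (fun y hy => by rw [slack_neg, h y hy, neg_zero]) x hx
  rw [slack_neg] at this
  linarith

/-- The zero set of a functional in `P`. -/
def zeroFace (e : AffFun N) (P : Set (Fin N → ℝ)) : Set (Fin N → ℝ) :=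
  {x ∈ P | slack e x = 0}

theorem isFaceOf_iff {F P : Set (Fin N → ℝ)} :
    IsFaceOf F P ↔ ∃ e : AffFun N, (∀ x ∈ P, 0 ≤ slack e x) ∧ F = zeroFace e P := by
  constructor
  · rintro ⟨c, b, h, rfl⟩
    refine ⟨(c, b), fun x hx => sub_nonneg.2 (h x hx), ?_⟩
    ext x
    simp only [zeroFace, slack, mem_ofPred_eq, sub_eq_zero, eq_comm (a := b)]
  · rintro ⟨⟨c, b⟩, h, rfl⟩
    refine ⟨c, b, fun x hx => sub_nonneg.1 (h x hx), ?_⟩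
    ext x
    simp only [zeroFace, slack, mem_ofPred_eq, sub_eq_zero, eq_comm (a := b)]

theorem IsFaceOf.subset {F P : Set (Fin N → ℝ)} (h : IsFaceOf F P) : F ⊆ P := by
  obtain ⟨e, -, rfl⟩ := isFaceOf_iff.1 h
  exact fun x hx => hx.1

theorem isFaceOf_empty (P : Set (Fin N → ℝ)) : IsFaceOf ∅ P :=
  isFaceOf_iff.2 ⟨(0, 1), fun x _ => by simp [slack_zero_one], by
    ext x; simp [zeroFace, slack_zero_one]⟩

theorem isFaceOf_self (P : Set (Fin N → ℝ)) : IsFaceOf P P :=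
  isFaceOf_iff.2 ⟨0, fun x _ => by simp [slack], by ext x; simp [zeroFace, slack]⟩

theorem zeroFace_convexHull {S : Finset (Fin N → ℝ)} {e : AffFun N}
    (he : ∀ s ∈ S, 0 ≤ slack e s) :
    zeroFace e (convexHull ℝ (S : Set (Fin N → ℝ))) =
      convexHull ℝ {s | s ∈ S ∧ slack e s = 0} := by
  apply Subset.antisymm
  · rintro x ⟨hx, h0⟩
    obtain ⟨w, hw, hw1, rfl, hwe⟩ := exists_weights hx
    rw [hwe, Finset.sum_eq_zero_iff_of_nonneg
      (fun s hs => mul_nonneg (hw s hs) (he s hs))] at h0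
    have hsub : (S.filter fun s => slack e s = 0) ⊆ S := Finset.filter_subset _ _
    have hz : ∀ s ∈ S, s ∉ (S.filter fun s => slack e s = 0) → w s = 0 := by
      intro s hs hs'
      have hne : slack e s ≠ 0 := fun h => hs' (Finset.mem_filter.2 ⟨hs, h⟩)
      exact (mul_eq_zero.1 (h0 s hs)).resolve_right hne
    rw [← Finset.sum_subset hsub (fun s hs hs' => by rw [hz s hs hs', zero_smul])]
    refine (convex_convexHull ℝ _).sum_mem (fun s hs => hw s (hsub hs)) ?_ ?_
    · rw [Finset.sum_subset hsub hz, hw1]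
    · intro s hs
      exact subset_convexHull ℝ _ (by simpa using hs)
  · intro x hx
    refine ⟨convexHull_mono (fun s hs => hs.1) hx, ?_⟩
    exact slack_eq_zero_of_mem_convexHull (fun s hs => hs.2) x hx

theorem IsPolytope.finite_faces {P : Set (Fin N → ℝ)} (hP : IsPolytope P) :
    {F | IsFaceOf F P}.Finite := by
  obtain ⟨S, rfl⟩ := hP
  refine (S.finite_toSet.finite_subsets.image fun T => convexHull ℝ T).subset ?_
  intro F hF
  obtain ⟨e, he, rfl⟩ := isFaceOf_iff.1 hF
  exact ⟨{s | s ∈ S ∧ slack e s = 0}, fun s hs => hs.1,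
    (zeroFace_convexHull fun s hs => he s (subset_convexHull ℝ _ hs)).symm⟩

/-! ### Functionals vanishing on a set -/

/-- The affine functionals vanishing on `X`. -/
def annihilator (X : Set (Fin N → ℝ)) : Submodule ℝ (AffFun N) where
  carrier := {e | ∀ x ∈ X, slack e x = 0}
  add_mem' h h' x hx := by rw [slack_add, h x hx, h' x hx, add_zero]
  zero_mem' x _ := (slackAt x).map_zero
  smul_mem' t e h x hx := by rw [slack_smul, h x hx, mul_zero]

theorem mem_annihilator {X : Set (Fin N → ℝ)} {e : AffFun N} :
    e ∈ annihilator X ↔ ∀ x ∈ X, slack e x = 0 := Iff.rfl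

theorem annihilator_anti {X Y : Set (Fin N → ℝ)} (h : X ⊆ Y) :
    annihilator Y ≤ annihilator X := fun _ he x hx => he x (h hx)

theorem pdim_add_finrank_annihilator (X : Set (Fin N → ℝ)) :
    pdim X + Module.finrank ℝ (annihilator X) = N := by
  unfold pdim
  split_ifs with hX
  · obtain ⟨x₀, hx₀⟩ := hX
    let f : AffFun N →ₗ[ℝ] Module.Dual ℝ (Fin N → ℝ) :=
      (dotProductEquiv ℝ (Fin N)).toLinearMap ∘ₗ LinearMap.fst ℝ _ _
    have hf : ∀ e v, f e v = ∑ i, e.1 i * v i := fun e v => rfl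
    have hinj : Function.Injective (f ∘ₗ (annihilator X).subtype) := by
      rw [← LinearMap.ker_eq_bot, LinearMap.ker_eq_bot']
      rintro ⟨⟨c, b⟩, he⟩ h0
      have hc : c = 0 := (dotProductEquiv ℝ (Fin N)).map_eq_zero_iff.1 h0
      subst hc
      have := he x₀ hx₀
      simp only [slack, Pi.zero_apply, zero_mul, Finset.sum_const_zero, sub_zero] at this
      subst this
      rfl
    have hrange : LinearMap.range (f ∘ₗ (annihilator X).subtype) =
        (affineSpan ℝ X).direction.dualAnnihilator := by
      rw [direction_affineSpan, vectorSpan_eq_span_vsub_set_right ℝ hx₀]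
      apply le_antisymm
      · rintro _ ⟨⟨e, he⟩, rfl⟩
        rw [Submodule.mem_dualAnnihilator]
        suffices h : Submodule.span ℝ ((· -ᵥ x₀) '' X) ≤ LinearMap.ker (f e) from
          fun w hw => h hw
        rw [Submodule.span_le]
        rintro _ ⟨x, hx, rfl⟩
        have h1 := he x hx
        have h2 := he x₀ hx₀
        simp only [slack] at h1 h2
        simp only [SetLike.mem_coe, LinearMap.mem_ker, hf, vsub_eq_sub, Pi.sub_apply, mul_sub,
          Finset.sum_sub_distrib]
        linarith
      · intro g hg
        rw [Submodule.mem_dualAnnihilator] at hg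
        obtain ⟨c, rfl⟩ := (dotProductEquiv ℝ (Fin N)).surjective g
        refine ⟨⟨(c, ∑ i, c i * x₀ i), fun x hx => ?_⟩, rfl⟩
        have := hg _ (Submodule.subset_span ⟨x, hx, rfl⟩)
        change ∑ i, c i * (x i - x₀ i) = 0 at this
        simp only [mul_sub, Finset.sum_sub_distrib] at this
        simp only [slack]
        linarith
    have h1 := LinearMap.finrank_range_of_inj hinj
    rw [hrange] at h1
    have h2 := Subspace.finrank_add_finrank_dualAnnihilator_eq (affineSpan ℝ X).direction
    rw [h1, Module.finrank_fin_fun] at h2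
    exact_mod_cast h2
  · have hX' : X = ∅ := not_nonempty_iff_eq_empty.1 hX
    subst hX'
    have : annihilator (∅ : Set (Fin N → ℝ)) = ⊤ := by
      ext e; simp [mem_annihilator]
    rw [this, finrank_top]
    simp

theorem finrank_quotient_annihilator (X : Set (Fin N → ℝ)) :
    (Module.finrank ℝ (AffFun N ⧸ annihilator X) : ℤ) = pdim X + 1 := by
  have h1 := Submodule.finrank_quotient_add_finrank (annihilator X)
  have h2 := pdim_add_finrank_annihilator X
  simp only [Module.finrank_prod, Module.finrank_fin_fun, Module.finrank_self] at h1
  omega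

end Slack

/-! ### Generating systems of functionals -/

section Generates

variable {N : ℕ} {κ : Type*} [Fintype κ]

/-- The functionals `ℓ` generate, modulo functionals vanishing on `P`, the cone of functionals
nonnegative on `P`. -/
structure Generates (P : Set (Fin N → ℝ)) (ℓ : κ → AffFun N) : Prop where
  nonneg : ∀ i, ∀ x ∈ P, 0 ≤ slack (ℓ i) x
  exists_coeff : ∀ e : AffFun N, (∀ x ∈ P, 0 ≤ slack e x) →
    ∃ μ : κ → ℝ, (∀ i, 0 ≤ μ i) ∧ ∀ x ∈ P, slack e x = ∑ i, μ i * slack (ℓ i) x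

/-- A functional that is nonnegative on `P` can be lowered along a functional vanishing on its
zero face until it acquires a new zero. -/
theorem exists_sub_smul_nonneg {S : Finset (Fin N → ℝ)} {e ψ : AffFun N}
    (he : ∀ s ∈ S, 0 ≤ slack e s) (hne : ∃ s ∈ S, slack e s ≠ 0)
    (hψ : ∀ s ∈ S, slack e s = 0 → slack ψ s = 0) :
    ∃ m : ℝ, (∀ s ∈ S, 0 ≤ slack (ψ - m • e) s) ∧
      (S.filter fun s => slack (ψ - m • e) s ≠ 0).card <
        (S.filter fun s => slack e s ≠ 0).card := by
  have hne' : (S.filter fun s => slack e s ≠ 0).Nonempty := by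
    obtain ⟨s, hs, h⟩ := hne
    exact ⟨s, Finset.mem_filter.2 ⟨hs, h⟩⟩
  obtain ⟨s₀, hs₀, hmin⟩ :=
    Finset.exists_min_image _ (fun s => slack ψ s / slack e s) hne'
  rw [Finset.mem_filter] at hs₀
  have hval : ∀ s, slack (ψ - (slack ψ s₀ / slack e s₀) • e) s =
      slack ψ s - slack ψ s₀ / slack e s₀ * slack e s := fun s => by
    rw [slack_sub, slack_smul]
  refine ⟨slack ψ s₀ / slack e s₀, fun s hs => ?_, Finset.card_lt_card ?_⟩
  · rw [hval]
    by_cases h : slack e s = 0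
    · rw [hψ s hs h, h]; simp
    · have h1 := hmin s (Finset.mem_filter.2 ⟨hs, h⟩)
      have h2 : 0 < slack e s := lt_of_le_of_ne (he s hs) (Ne.symm h)
      rw [le_div_iff₀ h2] at h1
      linarith
  · rw [Finset.ssubset_iff_of_subset]
    · refine ⟨s₀, Finset.mem_filter.2 hs₀, fun h => ?_⟩
      refine (Finset.mem_filter.1 h).2 ?_
      rw [hval, div_mul_cancel₀ _ hs₀.2, sub_self]
    · intro s hs
      rw [Finset.mem_filter] at hs ⊢
      refine ⟨hs.1, fun h => hs.2 ?_⟩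
      rw [hval, hψ s hs.1 h, h]; simp

/-- If `V` has dimension one more than `U`, then `V` is spanned by `U` and any vector of
`V` outside `U`. -/
theorem Submodule.exists_sub_smul_mem_of_finrank {W : Type*} [AddCommGroup W] [Module ℝ W]
    [FiniteDimensional ℝ W] {U V : Submodule ℝ W} (hUV : U ≤ V)
    (h : Module.finrank ℝ V ≤ Module.finrank ℝ U + 1) {v w : W} (hv : v ∈ V) (hvU : v ∉ U)
    (hw : w ∈ V) : ∃ t : ℝ, w - t • v ∈ U := by
  have hle : U ⊔ Submodule.span ℝ {v} ≤ V :=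
    sup_le hUV ((Submodule.span_singleton_le_iff_mem v V).2 hv)
  have hlt : U < U ⊔ Submodule.span ℝ {v} := by
    refine lt_of_le_of_ne le_sup_left fun h => hvU ?_
    rw [h]
    exact Submodule.mem_sup_right (Submodule.mem_span_singleton_self v)
  have heq := Submodule.eq_of_le_of_finrank_le hle
    (h.trans (Submodule.finrank_lt_finrank_of_lt hlt))
  rw [← heq, Submodule.mem_sup] at hw
  obtain ⟨u, hu, z, hz, rfl⟩ := hw
  obtain ⟨t, rfl⟩ := Submodule.mem_span_singleton.1 hz
  exact ⟨t, by simpa using hu⟩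

theorem isFacetOf_iff_finrank {F P : Set (Fin N → ℝ)} :
    IsFacetOf F P ↔ IsFaceOf F P ∧
      Module.finrank ℝ (annihilator F) = Module.finrank ℝ (annihilator P) + 1 := by
  have h1 := pdim_add_finrank_annihilator F
  have h2 := pdim_add_finrank_annihilator P
  exact and_congr_right fun _ => by omega

theorem mem_annihilator_zeroFace (e : AffFun N) (P : Set (Fin N → ℝ)) :
    e ∈ annihilator (zeroFace e P) := fun _ hx => hx.2

/-- The functional defining a facet does not vanish on the polytope. -/
theorem IsFacetOf.notMem_annihilator {F P : Set (Fin N → ℝ)} (hF : IsFacetOf F P)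
    {e : AffFun N} (he : F = zeroFace e P) : e ∉ annihilator P := by
  intro h
  have : F = P := by
    rw [he]; exact Subset.antisymm (fun x hx => hx.1) fun x hx => ⟨hx, h x hx⟩
  have h2 := hF.2
  rw [this] at h2
  omega

theorem IsFacetOf.exists_sub_smul_mem {F P : Set (Fin N → ℝ)} (hF : IsFacetOf F P)
    {e e' : AffFun N} (he : F = zeroFace e P) (he' : e' ∈ annihilator F) :
    ∃ t : ℝ, e' - t • e ∈ annihilator P :=
  Submodule.exists_sub_smul_mem_of_finrank (annihilator_anti hF.1.subset)
    (isFacetOf_iff_finrank.1 hF).2.le (he ▸ mem_annihilator_zeroFace e P)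
    (hF.notMem_annihilator he) he'

theorem IsPolytope.finite_facets {P : Set (Fin N → ℝ)} (hP : IsPolytope P) :
    Finite {F // IsFacetOf F P} :=
  (hP.finite_faces.subset fun _ hF => hF.1).to_subtype

/-- The facet-defining functionals generate the nonnegative functionals. -/
theorem IsPolytope.exists_coeff {P : Set (Fin N → ℝ)} (hP : IsPolytope P)
    [Fintype {F // IsFacetOf F P}] {ℓ : {F // IsFacetOf F P} → AffFun N}
    (hℓ : ∀ F, ∀ x ∈ P, 0 ≤ slack (ℓ F) x) (hz : ∀ F, F.1 = zeroFace (ℓ F) P)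
    (e : AffFun N) (he : ∀ x ∈ P, 0 ≤ slack e x) :
    ∃ μ : {F // IsFacetOf F P} → ℝ, (∀ F, 0 ≤ μ F) ∧
      ∀ x ∈ P, slack e x = ∑ F, μ F * slack (ℓ F) x := by
  classical
  obtain ⟨S, rfl⟩ := hP
  induction hn : (S.filter fun s => slack e s ≠ 0).card using Nat.strong_induction_on
    generalizing e with
  | _ n ih =>
    subst hn
    have hS : ∀ s ∈ S, s ∈ convexHull ℝ (S : Set (Fin N → ℝ)) :=
      fun s hs => subset_convexHull ℝ _ hs
    by_cases hann : e ∈ annihilator (convexHull ℝ (S : Set (Fin N → ℝ)))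
    · exact ⟨0, fun _ => le_rfl, fun x hx => by simp [hann x hx]⟩
    have hface : IsFaceOf (zeroFace e (convexHull ℝ (S : Set (Fin N → ℝ)))) _ :=
      isFaceOf_iff.2 ⟨e, he, rfl⟩
    by_cases hfacet : IsFacetOf (zeroFace e (convexHull ℝ (S : Set (Fin N → ℝ)))) (convexHull ℝ S)
    · obtain ⟨t, ht⟩ := hfacet.exists_sub_smul_mem (hz ⟨_, hfacet⟩) (mem_annihilator_zeroFace e _)
      have hval : ∀ x ∈ convexHull ℝ (S : Set (Fin N → ℝ)),
          slack e x = t * slack (ℓ ⟨_, hfacet⟩) x := fun x hx => by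
        have := ht x hx
        rw [slack_sub, slack_smul] at this
        linarith
      refine ⟨Pi.single ⟨_, hfacet⟩ t, fun F => ?_, fun x hx => ?_⟩
      · by_cases hF : F = ⟨_, hfacet⟩
        · subst hF
          rw [Pi.single_eq_same]
          by_contra! hneg
          refine hann fun x hx => le_antisymm ?_ (he x hx)
          rw [hval x hx]
          exact mul_nonpos_of_nonpos_of_nonneg hneg.le (hℓ _ x hx)
        · rw [Pi.single_eq_of_ne hF]
      · rw [Finset.sum_eq_single ⟨_, hfacet⟩, Pi.single_eq_same, hval x hx]
        · intro F _ hF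
          rw [Pi.single_eq_of_ne hF, zero_mul]
        · simp
    obtain ⟨ψ, hψ, hψt⟩ : ∃ ψ ∈ annihilator (zeroFace e (convexHull ℝ (S : Set (Fin N → ℝ)))),
        ∀ t : ℝ, ψ - t • e ∉ annihilator (convexHull ℝ (S : Set (Fin N → ℝ))) := by
      by_contra! hcon
      refine hfacet (isFacetOf_iff_finrank.2 ⟨hface, le_antisymm ?_ ?_⟩)
      · have hle : annihilator (zeroFace e (convexHull ℝ (S : Set (Fin N → ℝ)))) ≤
            annihilator (convexHull ℝ (S : Set (Fin N → ℝ))) ⊔ Submodule.span ℝ {e} := by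
          intro ψ hψ
          obtain ⟨t, ht⟩ := hcon ψ hψ
          rw [Submodule.mem_sup]
          exact ⟨_, ht, t • e, Submodule.smul_mem _ _ (Submodule.mem_span_singleton_self e),
            by simp⟩
        refine (Submodule.finrank_mono hle).trans ((Submodule.finrank_add_le_finrank_add_finrank
          _ _).trans ?_)
        gcongr
        exact (finrank_span_le_card {e}).trans (by simp)
      · refine Submodule.finrank_lt_finrank_of_lt
          (lt_of_le_of_ne (annihilator_anti hface.subset) fun h => hann ?_)
        rw [h]; exact mem_annihilator_zeroFace e _
    have heS : ∀ s ∈ S, 0 ≤ slack e s := fun s hs => he s (hS s hs)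
    have hpos : ∃ s ∈ S, slack e s ≠ 0 := by
      by_contra! hcon
      exact hann (slack_eq_zero_of_mem_convexHull hcon)
    have hψS : ∀ s ∈ S, slack e s = 0 → slack ψ s = 0 := fun s hs h => hψ s ⟨hS s hs, h⟩
    obtain ⟨m, hm, hmc⟩ := exists_sub_smul_nonneg heS hpos hψS
    obtain ⟨m', hm', hmc'⟩ := exists_sub_smul_nonneg (ψ := -ψ) heS hpos
      fun s hs h => by rw [slack_neg, hψS s hs h, neg_zero]
    have hsum : ∀ x, slack (ψ - m • e) x + slack (-ψ - m' • e) x = -(m + m') * slack e x := by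
      intro x
      simp only [slack_sub, slack_smul, slack_neg]
      ring
    have hmm : 0 < -(m + m') := by
      by_contra! hcon
      refine hψt m (slack_eq_zero_of_mem_convexHull fun s hs => le_antisymm ?_ (hm s hs))
      have h1 := hsum s
      have h2 := hm' s hs
      have h3 := mul_nonpos_of_nonpos_of_nonneg hcon (heS s hs)
      linarith
    obtain ⟨μ, hμ, hμe⟩ := ih _ hmc _ (slack_nonneg_of_mem_convexHull hm) rfl
    obtain ⟨μ', hμ', hμe'⟩ := ih _ hmc' _ (slack_nonneg_of_mem_convexHull hm') rfl
    refine ⟨fun F => (-(m + m'))⁻¹ * (μ F + μ' F), fun F => ?_, fun x hx => ?_⟩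
    · have := hμ F
      have := hμ' F
      positivity
    · have h := hsum x
      rw [hμe x hx, hμe' x hx, ← Finset.sum_add_distrib] at h
      have h' : ∑ F, (-(m + m'))⁻¹ * (μ F + μ' F) * slack (ℓ F) x =
          (-(m + m'))⁻¹ * ∑ F, (μ F * slack (ℓ F) x + μ' F * slack (ℓ F) x) := by
        rw [Finset.mul_sum]
        exact Finset.sum_congr rfl fun F _ => by ring
      rw [h', h, ← mul_assoc, inv_mul_cancel₀ hmm.ne', one_mul]

/-- A polytope has a generating system of functionals indexed by its facets. -/
theorem IsPolytope.exists_generates {P : Set (Fin N → ℝ)} (hP : IsPolytope P)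
    [Fintype {F // IsFacetOf F P}] : ∃ ℓ : {F // IsFacetOf F P} → AffFun N,
      Generates P ℓ ∧ ∀ F, F.1 = zeroFace (ℓ F) P := by
  choose ℓ hℓ hz using fun F : {F // IsFacetOf F P} => isFaceOf_iff.1 F.2.1
  exact ⟨ℓ, ⟨hℓ, hP.exists_coeff hℓ hz⟩, hz⟩

end Generates

/-! ### Linear relations between generating functionals -/

section Relations

theorem exists_forall_le_mul {X : Type*} (S : Finset X) (θ φ : X → ℝ)
    (hφ : ∀ s ∈ S, 0 < φ s) : ∃ M : ℝ, 0 ≤ M ∧ ∀ s ∈ S, θ s ≤ M * φ s := by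
  have hnn : ∀ s ∈ S, 0 ≤ |θ s| / φ s := fun s hs => div_nonneg (abs_nonneg _) (hφ s hs).le
  refine ⟨∑ s ∈ S, |θ s| / φ s, Finset.sum_nonneg hnn, fun s hs => ?_⟩
  rw [← div_le_iff₀ (hφ s hs)]
  refine le_trans ?_ (Finset.single_le_sum hnn hs)
  have := hφ s hs
  gcongr
  exact le_abs_self _

variable {N : ℕ} {κ : Type*} [Fintype κ]

/-- The linear relations between the functionals `ℓ` on `P`. -/
def relations (P : Set (Fin N → ℝ)) (ℓ : κ → AffFun N) : Submodule ℝ (κ → ℝ) :=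
  LinearMap.ker ((annihilator P).mkQ ∘ₗ Fintype.linearCombination ℝ ℓ)

theorem mem_relations {P : Set (Fin N → ℝ)} {ℓ : κ → AffFun N} {ρ : κ → ℝ} :
    ρ ∈ relations P ℓ ↔ ∀ x ∈ P, ∑ i, ρ i * slack (ℓ i) x = 0 := by
  rw [relations, LinearMap.mem_ker, LinearMap.comp_apply, Submodule.mkQ_apply,
    Submodule.Quotient.mk_eq_zero, mem_annihilator]
  simp only [Fintype.linearCombination_apply, slack_sum_smul]

theorem Generates.finrank_relations {P : Set (Fin N → ℝ)} (hP : IsPolytope P)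
    {ℓ : κ → AffFun N} (h : Generates P ℓ) :
    (Module.finrank ℝ (relations P ℓ) : ℤ) + pdim P + 1 = Fintype.card κ := by
  have hsurj : Function.Surjective
      ((annihilator P).mkQ ∘ₗ Fintype.linearCombination ℝ ℓ) := by
    intro q
    obtain ⟨e, rfl⟩ := (annihilator P).mkQ_surjective q
    obtain ⟨S, rfl⟩ := hP
    obtain ⟨M, hM, hle⟩ := exists_forall_le_mul S (fun s => - slack e s) (fun _ => 1)
      (fun _ _ => one_pos)
    obtain ⟨μ, -, hμ⟩ := h.exists_coeff (e + M • ((0, 1) : AffFun N))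
      (slack_nonneg_of_mem_convexHull fun s hs => by
        have := hle s hs
        rw [slack_add, slack_smul, slack_zero_one]
        linarith)
    obtain ⟨ν, -, hν⟩ := h.exists_coeff (M • ((0, 1) : AffFun N))
      fun x _ => by rw [slack_smul, slack_zero_one]; linarith
    refine ⟨μ - ν, ?_⟩
    rw [LinearMap.comp_apply, Submodule.mkQ_apply, Submodule.mkQ_apply, Submodule.Quotient.eq,
      mem_annihilator]
    intro x hx
    have h1 := hμ x hx
    have h2 := hν x hx
    rw [slack_add] at h1
    rw [slack_sub, Fintype.linearCombination_apply, slack_sum_smul]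
    simp only [Pi.sub_apply, sub_mul, Finset.sum_sub_distrib]
    linarith
  have h1 := LinearMap.finrank_range_add_finrank_ker
    ((annihilator P).mkQ ∘ₗ Fintype.linearCombination ℝ ℓ)
  rw [LinearMap.range_eq_top.2 hsurj, finrank_top, Module.finrank_fintype_fun_eq_card] at h1
  have h2 := finrank_quotient_annihilator P
  have h3 : Module.finrank ℝ (relations P ℓ) = Module.finrank ℝ (LinearMap.ker
    ((annihilator P).mkQ ∘ₗ Fintype.linearCombination ℝ ℓ)) := rfl
  omega

/-- Either some point of the polytope has all its nonzero slacks in `J`, or there is a linear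
relation that is negative on `J`. -/
theorem Generates.exists_mem_or_relation {P : Set (Fin N → ℝ)} (hP : IsPolytope P)
    {ℓ : κ → AffFun N} (h : Generates P ℓ) (J : Set κ) :
    (∃ x ∈ P, ∀ i ∉ J, slack (ℓ i) x = 0) ∨ ∃ ρ ∈ relations P ℓ, ∀ i ∈ J, ρ i < 0 := by
  classical
  rw [or_iff_not_imp_left]
  intro hJ
  push Not at hJ
  obtain ⟨S, rfl⟩ := hP
  have hS : ∀ s ∈ S, s ∈ convexHull ℝ (S : Set (Fin N → ℝ)) :=
    fun s hs => subset_convexHull ℝ _ hs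
  obtain ⟨M, hM, hle⟩ := exists_forall_le_mul S
    (fun s => ∑ i, (if i ∈ J then 1 else 0) * slack (ℓ i) s)
    (fun s => ∑ i, (if i ∈ J then 0 else 1) * slack (ℓ i) s) fun s hs => by
      obtain ⟨i, hi, hne⟩ := hJ s (hS s hs)
      refine Finset.sum_pos' (fun j _ => ?_) ⟨i, Finset.mem_univ i, ?_⟩
      · have := h.nonneg j s (hS s hs)
        positivity
      · rw [if_neg hi, one_mul]
        exact lt_of_le_of_ne (h.nonneg i s (hS s hs)) hne.symm
  obtain ⟨μ, hμ, hμe⟩ := h.exists_coeff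
    (∑ i, (M * (if i ∈ J then 0 else 1) - (if i ∈ J then 1 else 0)) • ℓ i)
    (slack_nonneg_of_mem_convexHull fun s hs => by
      have := hle s hs
      rw [slack_sum_smul]
      simp only [sub_mul, Finset.sum_sub_distrib, mul_assoc, ← Finset.mul_sum]
      linarith)
  refine ⟨fun i => M * (if i ∈ J then 0 else 1) - (if i ∈ J then 1 else 0) - μ i,
    mem_relations.2 fun x hx => ?_, fun i hi => ?_⟩
  · have := hμe x hx
    rw [slack_sum_smul] at this
    simp only [sub_mul, Finset.sum_sub_distrib] at this ⊢
    linarith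
  · have := hμ i
    simp only [if_pos hi]
    linarith

theorem Generates.exists_slack_ne_zero {P : Set (Fin N → ℝ)} {ℓ : κ → AffFun N}
    (h : Generates P ℓ) {x : Fin N → ℝ} (hx : x ∈ P) : ∃ i, slack (ℓ i) x ≠ 0 := by
  obtain ⟨μ, -, hμ⟩ := h.exists_coeff (0, 1) fun x _ => by rw [slack_zero_one]; exact zero_le_one
  have h1 := hμ x hx
  rw [slack_zero_one] at h1
  by_contra! hcon
  simp [hcon] at h1

/-- A face contains every point whose nonzero slacks are all nonzero somewhere on the face. -/
theorem Generates.mem_zeroFace {P : Set (Fin N → ℝ)} {ℓ : κ → AffFun N} (h : Generates P ℓ)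
    {e : AffFun N} (he : ∀ x ∈ P, 0 ≤ slack e x) {x : Fin N → ℝ} (hx : x ∈ P)
    (hsupp : ∀ i, slack (ℓ i) x ≠ 0 → ∃ y ∈ zeroFace e P, slack (ℓ i) y ≠ 0) :
    x ∈ zeroFace e P := by
  obtain ⟨μ, hμ, hμe⟩ := h.exists_coeff e he
  refine ⟨hx, ?_⟩
  rw [hμe x hx]
  refine Finset.sum_eq_zero fun i _ => ?_
  by_cases hi : slack (ℓ i) x = 0
  · rw [hi, mul_zero]
  · obtain ⟨y, ⟨hy, hy0⟩, hne⟩ := hsupp i hi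
    rw [hμe y hy, Finset.sum_eq_zero_iff_of_nonneg
      (fun j _ => mul_nonneg (hμ j) (h.nonneg j y hy))] at hy0
    rw [(mul_eq_zero.1 (hy0 i (Finset.mem_univ i))).resolve_right hne, zero_mul]

end Relations

/-! ### Affine images -/

section Pullback

variable {M N : ℕ}

/-- Composition of an affine functional with an affine map. -/
def pullback (π : (Fin M → ℝ) →ᵃ[ℝ] (Fin N → ℝ)) : AffFun N →ₗ[ℝ] AffFun M where
  toFun f := (Matrix.vecMul f.1 (LinearMap.toMatrix' π.linear), slack f (π 0))
  map_add' f g := by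
    refine Prod.ext ?_ (slack_add f g (π 0))
    exact Matrix.add_vecMul (LinearMap.toMatrix' π.linear) f.1 g.1
  map_smul' t f := by
    refine Prod.ext ?_ (slack_smul t f (π 0))
    exact Matrix.smul_vecMul t f.1 (LinearMap.toMatrix' π.linear)

theorem slack_pullback (π : (Fin M → ℝ) →ᵃ[ℝ] (Fin N → ℝ)) (f : AffFun N) (x : Fin M → ℝ) :
    slack (pullback π f) x = slack f (π x) := by
  have h1 : π x = π.linear x + π 0 := congrFun π.decomp x
  have h2 : Matrix.vecMul f.1 (LinearMap.toMatrix' π.linear) ⬝ᵥ x = f.1 ⬝ᵥ π.linear x := by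
    rw [← Matrix.dotProduct_mulVec, LinearMap.toMatrix'_mulVec]
  have h3 : f.1 ⬝ᵥ π x = f.1 ⬝ᵥ π.linear x + f.1 ⬝ᵥ π 0 := by rw [h1, dotProduct_add]
  change (f.2 - f.1 ⬝ᵥ π 0) - Matrix.vecMul f.1 (LinearMap.toMatrix' π.linear) ⬝ᵥ x =
    f.2 - f.1 ⬝ᵥ π x
  rw [h2, h3]
  ring

theorem annihilator_image (π : (Fin M → ℝ) →ᵃ[ℝ] (Fin N → ℝ)) (Q : Set (Fin M → ℝ)) :
    annihilator (π '' Q) = (annihilator Q).comap (pullback π) := by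
  ext f
  simp [mem_annihilator, slack_pullback]

/-- The map induced by `pullback` modulo functionals vanishing on the polytopes. -/
def pullbackQuotient (π : (Fin M → ℝ) →ᵃ[ℝ] (Fin N → ℝ)) (Q : Set (Fin M → ℝ)) :
    (AffFun N ⧸ annihilator (π '' Q)) →ₗ[ℝ] (AffFun M ⧸ annihilator Q) :=
  Submodule.mapQ _ _ (pullback π) (annihilator_image π Q).le

theorem pullbackQuotient_injective (π : (Fin M → ℝ) →ᵃ[ℝ] (Fin N → ℝ)) (Q : Set (Fin M → ℝ)) :
    Function.Injective (pullbackQuotient π Q) := by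
  rw [← LinearMap.ker_eq_bot, pullbackQuotient, Submodule.mapQ, Submodule.ker_liftQ_eq_bot]
  rw [LinearMap.ker_comp, Submodule.ker_mkQ, annihilator_image]

theorem pdim_image_le (π : (Fin M → ℝ) →ᵃ[ℝ] (Fin N → ℝ)) (Q : Set (Fin M → ℝ)) :
    pdim (π '' Q) ≤ pdim Q := by
  have h := LinearMap.finrank_le_finrank_of_injective (pullbackQuotient_injective π Q)
  have h1 := finrank_quotient_annihilator Q
  have h2 := finrank_quotient_annihilator (π '' Q)
  omega

/-- If an affine map preserves the dimension, every functional factors through it. -/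
theorem exists_slack_eq_of_pdim_eq {π : (Fin M → ℝ) →ᵃ[ℝ] (Fin N → ℝ)} {Q : Set (Fin M → ℝ)}
    (h : pdim (π '' Q) = pdim Q) (e : AffFun M) :
    ∃ f : AffFun N, ∀ x ∈ Q, slack f (π x) = slack e x := by
  have h1 := finrank_quotient_annihilator Q
  have h2 := finrank_quotient_annihilator (π '' Q)
  have hsurj := (LinearMap.injective_iff_surjective_of_finrank_eq_finrank
    (f := pullbackQuotient π Q) (by omega)).1 (pullbackQuotient_injective π Q)
  obtain ⟨q, hq⟩ := hsurj ((annihilator Q).mkQ e)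
  obtain ⟨f, rfl⟩ := Submodule.mkQ_surjective _ q
  refine ⟨f, fun x hx => ?_⟩
  have := (Submodule.Quotient.eq _).1 hq x hx
  rw [slack_sub, slack_pullback] at this
  linarith

/-- The face lattice of `P`. -/
abbrev FaceLattice (P : Set (Fin N → ℝ)) : Type := {F : Set (Fin N → ℝ) // IsFaceOf F P}

theorem combEquiv_iff {P : Set (Fin M → ℝ)} {Q : Set (Fin N → ℝ)} :
    CombEquiv P Q ↔ Nonempty (FaceLattice P ≃o FaceLattice Q) :=
  ⟨fun ⟨φ, h⟩ => ⟨⟨φ, fun {a b} => (h a b).symm⟩⟩,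
    fun ⟨φ⟩ => ⟨φ.toEquiv, fun _ _ => (φ.map_rel_iff).symm⟩⟩

/-- An affine map preserving the dimension of `Q` induces a combinatorial equivalence. -/
theorem combEquiv_image {π : (Fin M → ℝ) →ᵃ[ℝ] (Fin N → ℝ)} {Q : Set (Fin M → ℝ)}
    (h : pdim (π '' Q) = pdim Q) : CombEquiv Q (π '' Q) := by
  have hback : ∀ F, IsFaceOf F Q → {x ∈ Q | π x ∈ π '' F} = F := by
    intro F hF
    obtain ⟨e, he, rfl⟩ := isFaceOf_iff.1 hF
    obtain ⟨f, hf⟩ := exists_slack_eq_of_pdim_eq h e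
    refine Subset.antisymm ?_ fun x hx => ⟨hx.1, x, hx, rfl⟩
    rintro x ⟨hx, y, hy, hxy⟩
    refine ⟨hx, ?_⟩
    rw [← hf x hx, ← hxy, hf y hy.1, hy.2]
  have himage : ∀ F, IsFaceOf F Q → IsFaceOf (π '' F) (π '' Q) := by
    intro F hF
    obtain ⟨e, he, rfl⟩ := isFaceOf_iff.1 hF
    obtain ⟨f, hf⟩ := exists_slack_eq_of_pdim_eq h e
    refine isFaceOf_iff.2 ⟨f, ?_, ?_⟩
    · rintro _ ⟨x, hx, rfl⟩
      rw [hf x hx]; exact he x hx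
    · ext y
      constructor
      · rintro ⟨x, hx, rfl⟩
        exact ⟨⟨x, hx.1, rfl⟩, by rw [hf x hx.1, hx.2]⟩
      · rintro ⟨⟨x, hx, rfl⟩, h0⟩
        exact ⟨x, ⟨hx, by rw [← hf x hx, h0]⟩, rfl⟩
  refine ⟨⟨fun F => ⟨π '' F.1, himage F.1 F.2⟩, fun G => ⟨{x ∈ Q | π x ∈ G.1}, ?_⟩,
    fun F => Subtype.ext (hback F.1 F.2), fun G => Subtype.ext ?_⟩, fun F₁ F₂ => ?_⟩
  · obtain ⟨f, hf, hG⟩ := isFaceOf_iff.1 G.2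
    refine isFaceOf_iff.2 ⟨pullback π f, fun x hx => ?_, ?_⟩
    · rw [slack_pullback]; exact hf _ ⟨x, hx, rfl⟩
    · ext x
      rw [hG]
      simp only [zeroFace, mem_ofPred_eq, slack_pullback]
      exact and_congr_right fun hx => and_iff_right ⟨x, hx, rfl⟩
  · ext y
    constructor
    · rintro ⟨x, ⟨-, hx⟩, rfl⟩
      exact hx
    · intro hy
      obtain ⟨x, hx, rfl⟩ := G.2.subset hy
      exact ⟨x, ⟨hx, hy⟩, rfl⟩
  · refine ⟨fun hF => image_mono hF, fun hF => ?_⟩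
    rw [← hback F₁.1 F₁.2, ← hback F₂.1 F₂.2]
    exact fun x hx => ⟨hx.1, hF hx.2⟩

/-- If no relation between the generating functionals of `Q` has a negative coefficient, then an
affine image of `Q` has at most as many vertices as there are functionals. -/
theorem Generates.vertexCount_image_le {κ : Type*} [Fintype κ]
    {π : (Fin M → ℝ) →ᵃ[ℝ] (Fin N → ℝ)} {Q : Set (Fin M → ℝ)} (hQ : IsPolytope Q)
    {ℓ : κ → AffFun M} (h : Generates Q ℓ) (hrel : relations Q ℓ = ⊥) :
    vertexCount (π '' Q) ≤ Fintype.card κ := by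
  have hex : ∀ i, ∃ x ∈ Q, ∀ j ≠ i, slack (ℓ j) x = 0 := by
    intro i
    refine (h.exists_mem_or_relation hQ {i}).resolve_right ?_
    rintro ⟨ρ, hρ, hneg⟩
    rw [hrel, Submodule.mem_bot] at hρ
    have := hneg i rfl
    simp [hρ] at this
  choose s hs hs0 using hex
  have hsub : vertexSet (π '' Q) ⊆ (fun i => π (s i)) '' univ := by
    intro v hv
    obtain ⟨f, hf, hfv⟩ := isFaceOf_iff.1 (show IsFaceOf {v} (π '' Q) from hv)
    have hv' : v ∈ zeroFace f (π '' Q) := hfv ▸ rfl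
    obtain ⟨⟨y, hy, rfl⟩, hy0⟩ := hv'
    obtain ⟨i, hi⟩ := h.exists_slack_ne_zero hy
    have hmem : s i ∈ zeroFace (pullback π f) Q := by
      refine h.mem_zeroFace (fun x hx => ?_) (hs i) fun j hj => ?_
      · rw [slack_pullback]; exact hf _ ⟨x, hx, rfl⟩
      · have hji : j = i := by_contra fun hji => hj (hs0 i j hji)
        subst hji
        exact ⟨y, ⟨hy, by rw [slack_pullback, hy0]⟩, hi⟩
    have : π (s i) ∈ ({π y} : Set (Fin N → ℝ)) := by
      rw [hfv]
      exact ⟨⟨_, hs i, rfl⟩, by rw [← slack_pullback]; exact hmem.2⟩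
    exact ⟨i, mem_univ i, this⟩
  calc vertexCount (π '' Q) ≤ ((fun i => π (s i)) '' univ).ncard :=
        ncard_le_ncard hsub (toFinite _)
    _ ≤ (univ : Set κ).ncard := ncard_image_le (toFinite _)
    _ = Fintype.card κ := by rw [ncard_univ, Nat.card_eq_fintype_card]

end Pullback

/-! ### Atoms and coatoms of the face lattice -/

section Atoms

variable {N : ℕ} {P : Set (Fin N → ℝ)}

instance : OrderBot (FaceLattice P) where
  bot := ⟨∅, isFaceOf_empty P⟩
  bot_le F := empty_subset F.1

instance : OrderTop (FaceLattice P) where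
  top := ⟨P, isFaceOf_self P⟩
  le_top F := F.2.subset

theorem IsFacetOf.ne {F : Set (Fin N → ℝ)} (hF : IsFacetOf F P) : F ≠ P := by
  rintro rfl
  have := hF.2
  omega

theorem IsPolytope.isCoatom_iff (hP : IsPolytope P) (F : FaceLattice P) :
    IsCoatom F ↔ IsFacetOf F.1 P := by
  constructor
  · rintro ⟨hne, hmax⟩
    have := hP.finite_facets
    have := Fintype.ofFinite {F // IsFacetOf F P}
    obtain ⟨ℓ, hgen, hz⟩ := hP.exists_generates
    obtain ⟨e, he, hFe⟩ := isFaceOf_iff.1 F.2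
    obtain ⟨μ, hμ, hμe⟩ := hgen.exists_coeff e he
    obtain ⟨x, hx, hxe⟩ : ∃ x ∈ P, slack e x ≠ 0 := by
      by_contra! hcon
      refine hne (Subtype.ext ?_)
      rw [hFe]
      exact Subset.antisymm (fun x hx => hx.1) fun x hx => ⟨hx, hcon x hx⟩
    rw [hμe x hx] at hxe
    obtain ⟨G, -, hG⟩ := Finset.exists_ne_zero_of_sum_ne_zero hxe
    have hle : F ≤ ⟨G.1, G.2.1⟩ := by
      change F.1 ⊆ G.1
      intro y hy
      rw [hFe] at hy
      have h0 := hy.2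
      rw [hμe y hy.1, Finset.sum_eq_zero_iff_of_nonneg
        (fun j _ => mul_nonneg (hμ j) (hgen.nonneg j y hy.1))] at h0
      rw [hz G]
      exact ⟨hy.1, (mul_eq_zero.1 (h0 G (Finset.mem_univ G))).resolve_left
        (left_ne_zero_of_mul hG)⟩
    rcases hle.eq_or_lt with h | h
    · rw [h]; exact G.2
    · exact absurd (congrArg Subtype.val (hmax _ h)) G.2.ne
  · intro hF
    refine ⟨fun h => hF.ne (congrArg Subtype.val h), fun G hG => Subtype.ext ?_⟩
    obtain ⟨e, he, hFe⟩ := isFaceOf_iff.1 F.2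
    obtain ⟨e', he', hGe⟩ := isFaceOf_iff.1 G.2
    have hann : e' ∈ annihilator F.1 := fun x hx => by
      have : x ∈ zeroFace e' P := hGe ▸ hG.le hx
      exact this.2
    obtain ⟨t, ht⟩ := hF.exists_sub_smul_mem hFe hann
    obtain ⟨x, hxG, hxF⟩ : ∃ x ∈ G.1, x ∉ F.1 := not_subset.1 hG.not_ge
    have hxe : slack e x ≠ 0 := fun h => hxF (by rw [hFe]; exact ⟨G.2.subset hxG, h⟩)
    have hxe' : slack e' x = 0 := by
      rw [hGe] at hxG; exact hxG.2
    have ht0 : t = 0 := by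
      have := ht x (G.2.subset hxG)
      rw [slack_sub, slack_smul, hxe', zero_sub, neg_eq_zero] at this
      exact (mul_eq_zero.1 this).resolve_right hxe
    rw [ht0, zero_smul, sub_zero] at ht
    change G.1 = P
    rw [hGe]
    exact Subset.antisymm (fun x hx => hx.1) fun x hx => ⟨hx, ht x hx⟩

theorem IsPolytope.facetCount_eq (hP : IsPolytope P) :
    facetCount P = Nat.card {F : FaceLattice P // IsCoatom F} := by
  rw [facetCount, ← Nat.card_coe_set_eq]
  exact Nat.card_congr
    { toFun := fun F => ⟨⟨F.1, F.2.1⟩, (hP.isCoatom_iff _).2 F.2⟩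
      invFun := fun F => ⟨F.1.1, (hP.isCoatom_iff _).1 F.2⟩
      left_inv := fun _ => rfl
      right_inv := fun _ => rfl }

/-- Minimizing a functional over a face gives a face. -/
theorem IsPolytope.isFaceOf_of_zeroFace (hP : IsPolytope P) {e ψ : AffFun N}
    (he : ∀ x ∈ P, 0 ≤ slack e x) (hψ : ∀ x ∈ zeroFace e P, 0 ≤ slack ψ x) :
    IsFaceOf {x ∈ zeroFace e P | slack ψ x = 0} P := by
  classical
  obtain ⟨S, rfl⟩ := hP
  have heS : ∀ s ∈ S, 0 ≤ slack e s := fun s hs => he s (subset_convexHull ℝ _ hs)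
  obtain ⟨M, hM, hle⟩ := exists_forall_le_mul (S.filter fun s => slack e s ≠ 0)
    (fun s => 1 - slack ψ s) (slack e) fun s hs => by
      rw [Finset.mem_filter] at hs
      exact lt_of_le_of_ne (heS s hs.1) hs.2.symm
  have hval : ∀ x, slack (M • e + ψ) x = M * slack e x + slack ψ x := fun x => by
    rw [slack_add, slack_smul]
  have hpos : ∀ s ∈ S, slack e s ≠ 0 → 1 ≤ slack (M • e + ψ) s := fun s hs hne => by
    have := hle s (Finset.mem_filter.2 ⟨hs, hne⟩)
    rw [hval]; linarith
  have hzero : ∀ s ∈ S, slack e s = 0 → 0 ≤ slack (M • e + ψ) s := fun s hs h => by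
    rw [hval, h, mul_zero, zero_add]
    exact hψ s ⟨subset_convexHull ℝ _ hs, h⟩
  have hS : ∀ s ∈ S, 0 ≤ slack (M • e + ψ) s := fun s hs => by
    by_cases h : slack e s = 0
    · exact hzero s hs h
    · exact zero_le_one.trans (hpos s hs h)
  refine isFaceOf_iff.2 ⟨M • e + ψ, slack_nonneg_of_mem_convexHull hS, ?_⟩
  apply Subset.antisymm
  · rintro x ⟨⟨hx, h0⟩, h1⟩
    exact ⟨hx, by rw [hval, h0, h1]; simp⟩
  · intro x hx
    have hxe : slack e x = 0 := by
      have hx' := hx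
      rw [zeroFace_convexHull hS] at hx'
      refine slack_eq_zero_of_mem_convexHull ?_ x hx'
      rintro s ⟨hs, h⟩
      by_contra hne
      have := hpos s hs hne
      linarith
    refine ⟨⟨hx.1, hxe⟩, ?_⟩
    have := hx.2
    rw [hval, hxe] at this
    linarith

theorem IsPolytope.isAtom_iff (hP : IsPolytope P) (F : FaceLattice P) :
    IsAtom F ↔ ∃ v, F.1 = {v} := by
  classical
  constructor
  · rintro ⟨hne, hmin⟩
    obtain ⟨S, hS⟩ := id hP
    obtain ⟨e, he, hFe⟩ := isFaceOf_iff.1 F.2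
    have heS : ∀ s ∈ S, 0 ≤ slack e s := fun s hs => he s (hS ▸ subset_convexHull ℝ _ hs)
    have hF : F.1 = convexHull ℝ {s | s ∈ S ∧ slack e s = 0} := by
      rw [hFe, hS, zeroFace_convexHull heS]
    have hFne : F.1.Nonempty := nonempty_iff_ne_empty.2 fun h => hne (Subtype.ext h)
    have hZ : (S.filter fun s => slack e s = 0).Nonempty := by
      rw [hF, convexHull_nonempty_iff] at hFne
      obtain ⟨s, hs⟩ := hFne
      exact ⟨s, Finset.mem_filter.2 hs⟩
    have hsub : F.1.Subsingleton := by
      intro x hx y hy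
      ext i
      obtain ⟨s₀, hs₀, hmax⟩ := Finset.exists_max_image _ (fun s => s i) hZ
      rw [Finset.mem_filter] at hs₀
      let ψ : AffFun N := (Pi.single i 1, s₀ i)
      have hψ : ∀ z, slack ψ z = s₀ i - z i := fun z => by
        simp [slack, ψ, Pi.single_apply]
      have hψF : ∀ z ∈ zeroFace e P, 0 ≤ slack ψ z := by
        rw [← hFe, hF]
        refine slack_nonneg_of_mem_convexHull fun s hs => ?_
        have := hmax s (Finset.mem_filter.2 hs)
        rw [hψ]; linarith
      have hface := hP.isFaceOf_of_zeroFace he hψF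
      have hle : (⟨_, hface⟩ : FaceLattice P) ≤ F := by
        change {x ∈ zeroFace e P | slack ψ x = 0} ⊆ F.1
        rw [hFe]
        exact fun z hz => hz.1
      rcases hle.eq_or_lt with h | h
      · have h' : F.1 = {x ∈ zeroFace e P | slack ψ x = 0} := (congrArg Subtype.val h).symm
        rw [h'] at hx hy
        have h1 := hx.2
        have h2 := hy.2
        rw [hψ] at h1 h2
        linarith
      · have h' : {x ∈ zeroFace e P | slack ψ x = 0} = ∅ := congrArg Subtype.val (hmin _ h)
        have : s₀ ∈ {x ∈ zeroFace e P | slack ψ x = 0} := by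
          refine ⟨⟨hS ▸ subset_convexHull ℝ _ hs₀.1, hs₀.2⟩, ?_⟩
          rw [hψ, sub_self]
        rw [h'] at this
        exact this.elim
    obtain ⟨v, hv⟩ := hFne
    exact ⟨v, hsub.eq_singleton_of_mem hv⟩
  · rintro ⟨v, hv⟩
    refine ⟨fun h => ?_, fun G hG => Subtype.ext ?_⟩
    · have : ({v} : Set (Fin N → ℝ)) = ∅ := hv.symm.trans (congrArg Subtype.val h)
      exact singleton_ne_empty v this
    · have hss : G.1 ⊂ F.1 := hG
      rw [hv] at hss
      exact ssubset_singleton_iff.1 hss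

theorem IsPolytope.vertexCount_eq (hP : IsPolytope P) :
    vertexCount P = Nat.card {F : FaceLattice P // IsAtom F} := by
  rw [vertexCount, ← Nat.card_coe_set_eq]
  refine Nat.card_congr (Equiv.ofBijective
    (fun v : vertexSet P => ⟨⟨{v.1}, v.2⟩, (hP.isAtom_iff _).2 ⟨v.1, rfl⟩⟩) ⟨?_, ?_⟩)
  · intro v w h
    have : ({v.1} : Set (Fin N → ℝ)) = {w.1} := congrArg (fun F => F.1.1) h
    exact Subtype.ext (singleton_injective this)
  · rintro ⟨⟨F, hF⟩, hA⟩
    obtain ⟨v, hv⟩ := (hP.isAtom_iff _).1 hA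
    change F = {v} at hv
    subst hv
    exact ⟨⟨v, hF⟩, rfl⟩

theorem OrderIso.card_atoms {α β : Type*} [PartialOrder α] [PartialOrder β] [OrderBot α]
    [OrderBot β] (φ : α ≃o β) : Nat.card {a : α // IsAtom a} = Nat.card {b : β // IsAtom b} :=
  Nat.card_congr (φ.toEquiv.subtypeEquiv fun a => (φ.isAtom_iff a).symm)

theorem OrderIso.card_coatoms {α β : Type*} [PartialOrder α] [PartialOrder β] [OrderTop α]
    [OrderTop β] (φ : α ≃o β) :
    Nat.card {a : α // IsCoatom a} = Nat.card {b : β // IsCoatom b} :=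
  Nat.card_congr (φ.toEquiv.subtypeEquiv fun a => (φ.isCoatom_iff a).symm)

end Atoms

/-! ### The lattice of balanced sets -/

section SignBalanced

variable {κ : Type*}

/-- Sets containing an element of positive sign iff they contain one of negative sign. -/
abbrev SignBalanced (σ : κ → ℝ) : Type _ := {T : Set κ // (∃ a ∈ T, 0 < σ a) ↔ ∃ b ∈ T, σ b < 0}

instance (σ : κ → ℝ) : OrderBot (SignBalanced σ) where
  bot := ⟨∅, by simp⟩
  bot_le T := empty_subset T.1

/-- The balanced set consisting of an element of sign zero. -/
def SignBalanced.single {σ : κ → ℝ} (c : {c // σ c = 0}) : SignBalanced σ :=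
  ⟨{c.1}, by simp [c.2]⟩

/-- The balanced set consisting of an element of positive and one of negative sign. -/
def SignBalanced.pair {σ : κ → ℝ} (a : {a // 0 < σ a}) (b : {b // σ b < 0}) : SignBalanced σ :=
  ⟨{a.1, b.1}, by simp [a.2, b.2]⟩

theorem SignBalanced.ne_bot_iff {σ : κ → ℝ} {T : SignBalanced σ} : T ≠ ⊥ ↔ T.1.Nonempty := by
  rw [nonempty_iff_ne_empty]
  exact not_congr ⟨fun h => congrArg Subtype.val h, fun h => Subtype.ext h⟩

theorem SignBalanced.isAtom_single {σ : κ → ℝ} (c : {c // σ c = 0}) :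
    IsAtom (SignBalanced.single c) := by
  refine ⟨SignBalanced.ne_bot_iff.2 (singleton_nonempty _), fun T hT => Subtype.ext ?_⟩
  have h : T.1 ⊂ {c.1} := hT
  exact ssubset_singleton_iff.1 h

theorem SignBalanced.isAtom_pair {σ : κ → ℝ} (a : {a // 0 < σ a}) (b : {b // σ b < 0}) :
    IsAtom (SignBalanced.pair a b) := by
  refine ⟨SignBalanced.ne_bot_iff.2 (insert_nonempty _ _), fun T hT => ?_⟩
  by_contra hne
  obtain ⟨x, hx⟩ := SignBalanced.ne_bot_iff.1 hne
  have hsub : ∀ y ∈ T.1, y = a.1 ∨ y = b.1 := fun y hy => hT.le hy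
  refine hT.not_ge ?_
  change {a.1, b.1} ⊆ T.1
  have ha : a.1 ∈ T.1 ∧ b.1 ∈ T.1 := by
    rcases hsub x hx with rfl | rfl
    · obtain ⟨y, hy, hneg⟩ := T.2.1 ⟨_, hx, a.2⟩
      rcases hsub y hy with rfl | rfl
      · exact absurd hneg a.2.not_gt
      · exact ⟨hx, hy⟩
    · obtain ⟨y, hy, hpos⟩ := T.2.2 ⟨_, hx, b.2⟩
      rcases hsub y hy with rfl | rfl
      · exact ⟨hy, hx⟩
      · exact absurd hpos b.2.not_gt
  exact insert_subset ha.1 (singleton_subset_iff.2 ha.2)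

theorem SignBalanced.exists_of_isAtom {σ : κ → ℝ} {T : SignBalanced σ} (hT : IsAtom T) :
    (∃ c, T = SignBalanced.single c) ∨ ∃ a b, T = SignBalanced.pair a b := by
  obtain ⟨x, hx⟩ := SignBalanced.ne_bot_iff.1 hT.1
  have key : (∃ a ∈ T.1, 0 < σ a) → ∃ a b, T = SignBalanced.pair a b := fun h => by
    obtain ⟨a, ha, hpos⟩ := h
    obtain ⟨b, hb, hneg⟩ := T.2.1 ⟨a, ha, hpos⟩
    refine ⟨⟨a, hpos⟩, ⟨b, hneg⟩, ?_⟩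
    have hle : SignBalanced.pair ⟨a, hpos⟩ ⟨b, hneg⟩ ≤ T :=
      insert_subset ha (singleton_subset_iff.2 hb)
    exact ((hT.le_iff.1 hle).resolve_left (SignBalanced.isAtom_pair _ _).1).symm
  rcases lt_trichotomy (σ x) 0 with h | h | h
  · exact Or.inr (key (T.2.2 ⟨x, hx, h⟩))
  · refine Or.inl ⟨⟨x, h⟩, ?_⟩
    have hle : SignBalanced.single ⟨x, h⟩ ≤ T := singleton_subset_iff.2 hx
    exact ((hT.le_iff.1 hle).resolve_left (SignBalanced.isAtom_single _).1).symm
  · exact Or.inr (key ⟨x, hx, h⟩)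

theorem SignBalanced.card_atoms [Finite κ] (σ : κ → ℝ) :
    Nat.card {T : SignBalanced σ // IsAtom T} =
      Nat.card {c // σ c = 0} + Nat.card {a // 0 < σ a} * Nat.card {b // σ b < 0} := by
  rw [← Nat.card_prod, ← Nat.card_sum]
  refine (Nat.card_congr (Equiv.ofBijective
    (Sum.elim (fun c => ⟨SignBalanced.single c, SignBalanced.isAtom_single c⟩)
      (fun p => ⟨SignBalanced.pair p.1 p.2, SignBalanced.isAtom_pair p.1 p.2⟩)) ⟨?_, ?_⟩)).symm
  · have hval : ∀ {T T' : {T : SignBalanced σ // IsAtom T}}, T = T' →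
        ∀ x, x ∈ T.1.1 → x ∈ T'.1.1 := by
      rintro T _ rfl x hx; exact hx
    rintro (c | ⟨a, b⟩) (c' | ⟨a', b'⟩) h
    · have : c.1 = c'.1 := hval h c.1 rfl
      rw [Subtype.ext this]
    · have : a'.1 = c.1 := hval h.symm a'.1 (Or.inl rfl)
      have h1 := a'.2
      rw [this, c.2] at h1
      exact absurd h1 (lt_irrefl _)
    · have : a.1 = c'.1 := hval h a.1 (Or.inl rfl)
      have h1 := a.2
      rw [this, c'.2] at h1
      exact absurd h1 (lt_irrefl _)
    · have h1 : a.1 = a'.1 := by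
        rcases hval h a.1 (Or.inl rfl) with h1 | h1
        · exact h1
        · have h2 := a.2
          rw [show a.1 = b'.1 from h1] at h2
          exact absurd b'.2 h2.not_gt
      have h2 : b.1 = b'.1 := by
        rcases hval h b.1 (Or.inr rfl) with h1 | h1
        · have h2 := b.2
          rw [show b.1 = a'.1 from h1] at h2
          exact absurd a'.2 h2.not_gt
        · exact h1
      rw [Subtype.ext h1, Subtype.ext h2]
  · rintro ⟨T, hT⟩
    rcases SignBalanced.exists_of_isAtom hT with ⟨c, rfl⟩ | ⟨a, b, rfl⟩
    · exact ⟨Sum.inl c, rfl⟩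
    · exact ⟨Sum.inr (a, b), rfl⟩

theorem SignBalanced.card_coatoms {σ : κ → ℝ} [OrderTop (SignBalanced σ)]
    (hpos : ∀ i, ∃ a, a ≠ i ∧ 0 < σ a) (hneg : ∀ i, ∃ b, b ≠ i ∧ σ b < 0) :
    Nat.card {T : SignBalanced σ // IsCoatom T} = Nat.card κ := by
  let f : κ → SignBalanced σ := fun i => ⟨{i}ᶜ, iff_of_true (hpos i) (hneg i)⟩
  have htop : ∀ T : SignBalanced σ, T ≠ ⊤ → ∃ i, T ≤ f i := by
    intro T hT
    by_contra! hcon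
    refine hT (top_le_iff.1 fun i _ => ?_)
    by_contra hi
    exact hcon i (fun j hj hji => hi (by rwa [← show j = i from hji]))
  have hf : ∀ i, IsCoatom (f i) := by
    intro i
    have hi : i ∉ (f i).1 := fun h => h rfl
    refine ⟨fun h => ?_, fun T hT => ?_⟩
    · have huniv : (⟨univ, iff_of_true ⟨_, mem_univ _, (hpos i).choose_spec.2⟩
          ⟨_, mem_univ _, (hneg i).choose_spec.2⟩⟩ : SignBalanced σ) ≤ f i := h ▸ le_top
      exact hi (huniv (mem_univ i))
    · by_contra hne
      obtain ⟨j, hj⟩ := htop T hne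
      have hij : (f i).1 ⊆ (f j).1 := hT.le.trans hj
      have : j = i := by
        by_contra hji
        exact hij (show j ∈ (f i).1 from hji) rfl
      subst this
      exact hT.not_ge hj
  refine (Nat.card_congr (Equiv.ofBijective (fun i => ⟨f i, hf i⟩) ⟨?_, ?_⟩)).symm
  · intro i j h
    have : ({i}ᶜ : Set κ) = {j}ᶜ := congrArg (fun T => T.1.1) h
    exact singleton_injective (compl_injective this)
  · rintro ⟨T, hT⟩
    obtain ⟨i, hi⟩ := htop T hT.1
    refine ⟨i, Subtype.ext ?_⟩
    exact (hT.le_iff.1 hi).resolve_left (hf i).1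

/-- A sign-preserving bijection induces an isomorphism of lattices of balanced sets. -/
def SignBalanced.congr {κ' : Type*} {σ : κ → ℝ} {τ : κ' → ℝ} (g : κ ≃ κ')
    (hpos : ∀ i, 0 < τ (g i) ↔ 0 < σ i) (hneg : ∀ i, τ (g i) < 0 ↔ σ i < 0) :
    SignBalanced σ ≃o SignBalanced τ where
  toEquiv := (Equiv.Set.congr g).subtypeEquiv fun T => by
    change _ ↔ ((∃ a ∈ g '' T, 0 < τ a) ↔ ∃ b ∈ g '' T, τ b < 0)
    simp only [exists_mem_image, hpos, hneg]
  map_rel_iff' {T T'} := image_subset_image_iff g.injective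

end SignBalanced

/-! ### Polytopes whose face lattice is a lattice of balanced sets -/

section FaceLatticeIso

variable {N : ℕ} {κ : Type*} [Fintype κ] {P : Set (Fin N → ℝ)} {ℓ : κ → AffFun N} {σ : κ → ℝ}

theorem Generates.exists_neg (h : Generates P ℓ) (hσ : σ ∈ relations P ℓ) {x : Fin N → ℝ}
    (hx : x ∈ P) {a : κ} (ha : 0 < σ a) (hax : slack (ℓ a) x ≠ 0) :
    ∃ b, σ b < 0 ∧ slack (ℓ b) x ≠ 0 := by
  by_contra! hcon
  have hnn : ∀ i ∈ Finset.univ, 0 ≤ σ i * slack (ℓ i) x := fun i _ => by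
    rcases lt_or_ge (σ i) 0 with hi | hi
    · rw [hcon i hi, mul_zero]
    · exact mul_nonneg hi (h.nonneg i x hx)
  have h0 := (Finset.sum_eq_zero_iff_of_nonneg hnn).1 (mem_relations.1 hσ x hx) a
    (Finset.mem_univ a)
  exact (mul_ne_zero ha.ne' hax) h0

theorem Generates.exists_pos (h : Generates P ℓ) (hσ : σ ∈ relations P ℓ) {x : Fin N → ℝ}
    (hx : x ∈ P) {b : κ} (hb : σ b < 0) (hbx : slack (ℓ b) x ≠ 0) :
    ∃ a, 0 < σ a ∧ slack (ℓ a) x ≠ 0 := by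
  obtain ⟨a, ha, hax⟩ := h.exists_neg (Submodule.neg_mem _ hσ) hx (a := b) (by simpa using hb) hbx
  exact ⟨a, by simpa using ha, hax⟩

theorem Generates.nonempty_orderIso (h : Generates P ℓ) (hσ : σ ∈ relations P ℓ)
    (hsingle : ∀ c, σ c = 0 → ∃ x ∈ P, ∀ j ≠ c, slack (ℓ j) x = 0)
    (hpair : ∀ a b, 0 < σ a → σ b < 0 → ∃ x ∈ P, ∀ j, j ≠ a → j ≠ b → slack (ℓ j) x = 0) :
    Nonempty (FaceLattice P ≃o SignBalanced σ) := by
  let f : FaceLattice P → SignBalanced σ := fun F => ⟨{i | ∃ x ∈ F.1, slack (ℓ i) x ≠ 0}, by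
    constructor
    · rintro ⟨a, ⟨x, hx, hax⟩, ha⟩
      obtain ⟨b, hb, hbx⟩ := h.exists_neg hσ (F.2.subset hx) ha hax
      exact ⟨b, ⟨x, hx, hbx⟩, hb⟩
    · rintro ⟨b, ⟨x, hx, hbx⟩, hb⟩
      obtain ⟨a, ha, hax⟩ := h.exists_pos hσ (F.2.subset hx) hb hbx
      exact ⟨a, ⟨x, hx, hax⟩, ha⟩⟩
  have hf : ∀ F G, f F ≤ f G ↔ F ≤ G := by
    intro F G
    constructor
    · intro hle x hx
      obtain ⟨e, he, hG⟩ := isFaceOf_iff.1 G.2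
      rw [hG]
      refine h.mem_zeroFace he (F.2.subset hx) fun i hi => ?_
      obtain ⟨y, hy, hyi⟩ := hle (show i ∈ (f F).1 from ⟨x, hx, hi⟩)
      exact ⟨y, hG ▸ hy, hyi⟩
    · rintro hle i ⟨x, hx, hi⟩
      exact ⟨x, hle hx, hi⟩
  have hpair' : ∀ a b, 0 < σ a → σ b < 0 → ∃ x ∈ P, (∀ j, j ≠ a → j ≠ b → slack (ℓ j) x = 0) ∧
      slack (ℓ a) x ≠ 0 ∧ slack (ℓ b) x ≠ 0 := by
    intro a b ha hb
    obtain ⟨x, hx, hab⟩ := hpair a b ha hb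
    have hor : ∀ j, slack (ℓ j) x ≠ 0 → j = a ∨ j = b := fun j hj => by
      by_contra! hcon
      exact hj (hab j hcon.1 hcon.2)
    have h1 : slack (ℓ a) x ≠ 0 → slack (ℓ b) x ≠ 0 := fun hax => by
      obtain ⟨j, hj, hjx⟩ := h.exists_neg hσ hx ha hax
      rcases hor j hjx with rfl | rfl
      · exact absurd hj ha.not_gt
      · exact hjx
    have h2 : slack (ℓ b) x ≠ 0 → slack (ℓ a) x ≠ 0 := fun hbx => by
      obtain ⟨j, hj, hjx⟩ := h.exists_pos hσ hx hb hbx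
      rcases hor j hjx with rfl | rfl
      · exact hjx
      · exact absurd hj hb.not_gt
    obtain ⟨j, hj⟩ := h.exists_slack_ne_zero hx
    refine ⟨x, hx, hab, ?_⟩
    rcases hor j hj with rfl | rfl
    · exact ⟨hj, h1 hj⟩
    · exact ⟨h2 hj, hj⟩
  refine ⟨RelIso.ofSurjective (OrderEmbedding.ofMapLEIff f hf) fun T => ?_⟩
  classical
  have hface : IsFaceOf {x ∈ P | ∀ i ∉ T.1, slack (ℓ i) x = 0} P := by
    refine isFaceOf_iff.2 ⟨∑ i ∈ Finset.univ.filter (· ∉ T.1), ℓ i, fun x hx => ?_, ?_⟩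
    · rw [slack_sum]
      exact Finset.sum_nonneg fun i _ => h.nonneg i x hx
    · ext x
      refine and_congr_right fun hx => ?_
      rw [slack_sum, Finset.sum_eq_zero_iff_of_nonneg fun i _ => h.nonneg i x hx]
      simp
  refine ⟨⟨_, hface⟩, Subtype.ext (Subset.antisymm ?_ ?_)⟩
  · rintro i ⟨x, hx, hi⟩
    by_contra hiT
    exact hi (hx.2 i hiT)
  · intro i hi
    rcases lt_trichotomy (σ i) 0 with hσi | hσi | hσi
    · obtain ⟨a, haT, ha⟩ := T.2.2 ⟨i, hi, hσi⟩
      obtain ⟨x, hx, h0, -, hne⟩ := hpair' a i ha hσi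
      exact ⟨x, ⟨hx, fun j hj => h0 j (fun e => hj (e ▸ haT)) fun e => hj (e ▸ hi)⟩, hne⟩
    · obtain ⟨x, hx, h0⟩ := hsingle i hσi
      refine ⟨x, ⟨hx, fun j hj => h0 j fun e => hj (e ▸ hi)⟩, ?_⟩
      obtain ⟨j, hj⟩ := h.exists_slack_ne_zero hx
      have hji : j = i := by
        by_contra hne
        exact hj (h0 j hne)
      rwa [← hji]
    · obtain ⟨b, hbT, hb⟩ := T.2.1 ⟨i, hi, hσi⟩
      obtain ⟨x, hx, h0, hne, -⟩ := hpair' i b hσi hb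
      exact ⟨x, ⟨hx, fun j hj => h0 j (fun e => hj (e ▸ hi)) fun e => hj (e ▸ hbT)⟩, hne⟩

/-- If the relations among the facet functionals are spanned by `σ`, the faces of the polytope are
encoded by the balanced sets of `σ`. -/
theorem Generates.nonempty_orderIso_of_span (hP : IsPolytope P) (h : Generates P ℓ)
    (hspan : relations P ℓ = Submodule.span ℝ {σ}) :
    Nonempty (FaceLattice P ≃o SignBalanced σ) := by
  refine h.nonempty_orderIso (hspan ▸ Submodule.mem_span_singleton_self σ) (fun c hc => ?_)
    fun a b ha hb => ?_
  · refine (h.exists_mem_or_relation hP {c}).resolve_right ?_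
    rintro ⟨ρ, hρ, hneg⟩
    rw [hspan, Submodule.mem_span_singleton] at hρ
    obtain ⟨t, rfl⟩ := hρ
    have := hneg c rfl
    simp [hc] at this
  · rcases h.exists_mem_or_relation hP {a, b} with ⟨x, hx, h0⟩ | ⟨ρ, hρ, hneg⟩
    · exact ⟨x, hx, fun j hja hjb => h0 j (by simp [hja, hjb])⟩
    · rw [hspan, Submodule.mem_span_singleton] at hρ
      obtain ⟨t, rfl⟩ := hρ
      have h1 := hneg a (Or.inl rfl)
      have h2 := hneg b (Or.inr rfl)
      simp only [Pi.smul_apply, smul_eq_mul] at h1 h2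
      nlinarith [mul_pos ha (neg_pos.2 hb)]

end FaceLatticeIso

section StdSign

/-- The sign function with `p` positive, `n` negative and `z` vanishing values. -/
def stdSign (p n z : ℕ) : Fin p ⊕ Fin n ⊕ Fin z → ℝ :=
  Sum.elim (fun _ => 1) (Sum.elim (fun _ => -1) fun _ => 0)

variable {κ : Type*} [Finite κ]

/-- Splitting the index set of a sign function. -/
def signSumEquiv (σ : κ → ℝ) : {a // 0 < σ a} ⊕ {b // σ b < 0} ⊕ {c // σ c = 0} ≃ κ :=
  Equiv.ofBijective (Sum.elim Subtype.val (Sum.elim Subtype.val Subtype.val)) <| by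
    constructor
    · rintro (⟨a, ha⟩ | ⟨a, ha⟩ | ⟨a, ha⟩) (⟨b, hb⟩ | ⟨b, hb⟩ | ⟨b, hb⟩) h <;>
        obtain rfl : a = b := h <;> first | rfl | linarith
    · intro i
      rcases lt_trichotomy (σ i) 0 with h | h | h
      exacts [⟨Sum.inr (Sum.inl ⟨i, h⟩), rfl⟩, ⟨Sum.inr (Sum.inr ⟨i, h⟩), rfl⟩,
        ⟨Sum.inl ⟨i, h⟩, rfl⟩]

theorem card_eq_sum_sign (σ : κ → ℝ) : Nat.card κ =
    Nat.card {a // 0 < σ a} + (Nat.card {b // σ b < 0} + Nat.card {c // σ c = 0}) := by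
  rw [← Nat.card_congr (signSumEquiv σ), Nat.card_sum, Nat.card_sum]

theorem SignBalanced.nonempty_orderIso_stdSign {σ : κ → ℝ} {p n z : ℕ}
    (hp : Nat.card {a // 0 < σ a} = p) (hn : Nat.card {b // σ b < 0} = n)
    (hz : Nat.card {c // σ c = 0} = z) :
    Nonempty (SignBalanced σ ≃o SignBalanced (stdSign p n z)) := by
  refine ⟨(SignBalanced.congr ((Equiv.sumCongr (Finite.equivFinOfCardEq hp).symm
    (Equiv.sumCongr (Finite.equivFinOfCardEq hn).symm
      (Finite.equivFinOfCardEq hz).symm)).trans (signSumEquiv σ)) ?_ ?_).symm⟩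
  · rintro (i | i | i)
    · exact iff_of_true (Subtype.prop ((Finite.equivFinOfCardEq hp).symm i)) zero_lt_one
    · exact iff_of_false (lt_asymm (Subtype.prop ((Finite.equivFinOfCardEq hn).symm i)))
        (by norm_num [stdSign])
    · exact iff_of_false (Subtype.prop ((Finite.equivFinOfCardEq hz).symm i)).not_gt
        (by norm_num [stdSign])
  · rintro (i | i | i)
    · exact iff_of_false (lt_asymm (Subtype.prop ((Finite.equivFinOfCardEq hp).symm i)))
        (by norm_num [stdSign])
    · exact iff_of_true (Subtype.prop ((Finite.equivFinOfCardEq hn).symm i))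
        (by norm_num [stdSign])
    · exact iff_of_false (Subtype.prop ((Finite.equivFinOfCardEq hz).symm i)).not_lt
        (by norm_num [stdSign])

/-- Exchanging the two signs does not affect the balanced sets. -/
def SignBalanced.negIso {κ : Type*} (σ : κ → ℝ) : SignBalanced σ ≃o SignBalanced (-σ) where
  toEquiv := Equiv.subtypeEquivRight fun T => by
    simp only [Pi.neg_apply, neg_pos, neg_neg_iff_pos]
    exact iff_comm
  map_rel_iff' := Iff.rfl

theorem card_pos_neg_of_add_eq {p n z d : ℕ} (hp : 0 < p) (hn : 0 < n)
    (hfacets : p + (n + z) = d + 2) (hvertices : z + p * n = d + 4) :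
    z + 4 = d ∧ (p = 2 ∧ n = 4 ∨ p = 4 ∧ n = 2) := by
  obtain ⟨p, rfl⟩ := Nat.exists_eq_add_of_le' hp
  obtain ⟨n, rfl⟩ := Nat.exists_eq_add_of_le' hn
  have h : p * n = 3 := by nlinarith
  rcases (Nat.dvd_prime Nat.prime_three).1 ⟨n, h.symm⟩ with rfl | rfl <;> omega

theorem IsPolytope.nonempty_orderIso_stdSign {N d : ℕ} {P : Set (Fin N → ℝ)} (hP : IsPolytope P)
    (hd : pdim P = d) (hv : vertexCount P = d + 4) (hf : facetCount P = d + 2) :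
    Nonempty (FaceLattice P ≃o SignBalanced (stdSign 2 4 (d - 4))) := by
  have := hP.finite_facets
  have := Fintype.ofFinite {F // IsFacetOf F P}
  obtain ⟨ℓ, hgen, hz⟩ := hP.exists_generates
  have hcard : Nat.card {F // IsFacetOf F P} = d + 2 := hf
  have hrank : Module.finrank ℝ (relations P ℓ) = 1 := by
    have := hgen.finrank_relations hP
    rw [← Nat.card_eq_fintype_card, hcard, hd] at this
    push_cast at this
    omega
  obtain ⟨⟨σ, hσ⟩, hσ0, hσspan⟩ := finrank_eq_one_iff'.1 hrank
  have hspan : relations P ℓ = Submodule.span ℝ {σ} := by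
    refine le_antisymm (fun ρ hρ => ?_) (Submodule.span_le.2 (singleton_subset_iff.2 hσ))
    obtain ⟨t, ht⟩ := hσspan ⟨ρ, hρ⟩
    exact Submodule.mem_span_singleton.2 ⟨t, congrArg Subtype.val ht⟩
  have hne : ∀ F, ∃ x ∈ P, slack (ℓ F) x ≠ 0 := fun F => by
    by_contra! hcon
    exact F.2.notMem_annihilator (hz F) hcon
  have hsigns : (∃ a, 0 < σ a) ∧ ∃ b, σ b < 0 := by
    obtain ⟨F, hF⟩ := Function.ne_iff.1 fun h => hσ0 (Subtype.ext h)
    obtain ⟨x, hx, hFx⟩ := hne F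
    rcases lt_or_gt_of_ne hF with h | h
    · obtain ⟨a, ha, -⟩ := hgen.exists_pos hσ hx h hFx
      exact ⟨⟨a, ha⟩, F, h⟩
    · obtain ⟨b, hb, -⟩ := hgen.exists_neg hσ hx h hFx
      exact ⟨⟨F, h⟩, b, hb⟩
  obtain ⟨φ⟩ := hgen.nonempty_orderIso_of_span hP hspan
  rw [hP.vertexCount_eq, φ.card_atoms, SignBalanced.card_atoms] at hv
  rw [card_eq_sum_sign σ] at hcard
  have hp : 0 < Nat.card {a // 0 < σ a} :=
    Nat.card_pos_iff.2 ⟨⟨_, hsigns.1.choose_spec⟩, inferInstance⟩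
  have hn : 0 < Nat.card {b // σ b < 0} :=
    Nat.card_pos_iff.2 ⟨⟨_, hsigns.2.choose_spec⟩, inferInstance⟩
  obtain ⟨hz4, ⟨h2, h4⟩ | ⟨h4, h2⟩⟩ := card_pos_neg_of_add_eq hp hn hcard hv
  · obtain ⟨ψ⟩ := SignBalanced.nonempty_orderIso_stdSign h2 h4 (Nat.eq_sub_of_add_eq hz4)
    exact ⟨φ.trans ψ⟩
  · obtain ⟨ψ⟩ := SignBalanced.nonempty_orderIso_stdSign (σ := -σ) (p := 2) (n := 4) (z := d - 4)
      (by simpa using h2) (by simpa using h4) (by simpa using Nat.eq_sub_of_add_eq hz4)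
    exact ⟨(φ.trans (SignBalanced.negIso σ)).trans ψ⟩

theorem card_subtype_sum {α β : Type*} [Finite α] [Finite β] (q : α ⊕ β → Prop) :
    Nat.card {c // q c} = Nat.card {a // q (Sum.inl a)} + Nat.card {b // q (Sum.inr b)} := by
  rw [Nat.card_congr Equiv.subtypeSum, Nat.card_sum]

theorem card_isAtom_stdSign (p n z : ℕ) :
    Nat.card {T : SignBalanced (stdSign p n z) // IsAtom T} = z + p * n := by
  rw [SignBalanced.card_atoms, card_subtype_sum, card_subtype_sum, card_subtype_sum,
    card_subtype_sum, card_subtype_sum, card_subtype_sum]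
  simp [stdSign]
  norm_num

theorem IsPolytope.facetCount_eq_of_orderIso {N k : ℕ} {P : Set (Fin N → ℝ)} (hP : IsPolytope P)
    (φ : FaceLattice P ≃o SignBalanced (stdSign 2 4 k)) :
    facetCount P = k + 6 := by
  let _ : OrderTop (SignBalanced (stdSign 2 4 k)) :=
    { top := ⟨univ, by simp [stdSign]⟩
      le_top := fun T => subset_univ T.1 }
  rw [hP.facetCount_eq, φ.card_coatoms, SignBalanced.card_coatoms]
  · simp
    ring
  · rintro (i | i)
    · obtain ⟨j, hj⟩ := exists_ne i
      exact ⟨Sum.inl j, by simpa using hj, by simp [stdSign]⟩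
    · exact ⟨Sum.inl 0, by simp, by simp [stdSign]⟩
  · rintro (i | i | i)
    · exact ⟨Sum.inr (Sum.inl 0), by simp, by simp [stdSign]⟩
    · obtain ⟨j, hj⟩ := exists_ne i
      exact ⟨Sum.inr (Sum.inl j), by simpa using hj, by simp [stdSign]⟩
    · exact ⟨Sum.inr (Sum.inl 0), by simp, by simp [stdSign]⟩

end StdSign

/-! ### The iterated pyramid over the product of a segment and a tetrahedron -/

section PyramidOverProduct

variable {k : ℕ}

/-- The point of the ambient space of the pyramid with the given coordinates. -/
def coords (x : ℝ) (y : Fin 3 → ℝ) (c : Fin k → ℝ) : Fin (1 + 3 + k) → ℝ :=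
  Fin.append (Fin.append (fun _ : Fin 1 => x) y) c

theorem exists_eq_coords (z : Fin (1 + 3 + k) → ℝ) : ∃ x y c, z = coords x y c := by
  refine ⟨z (Fin.castAdd k (Fin.castAdd 3 0)), fun j => z (Fin.castAdd k (Fin.natAdd 1 j)),
    fun j => z (Fin.natAdd (1 + 3) j), ?_⟩
  rw [coords]
  conv_lhs => rw [← Fin.append_castAdd_natAdd (f := z),
    ← Fin.append_castAdd_natAdd (f := fun i => z (Fin.castAdd k i))]
  congr 2
  ext i
  rw [Subsingleton.elim i 0]

theorem slack_coords (u : ℝ) (v : Fin 3 → ℝ) (w : Fin k → ℝ) (b x : ℝ) (y : Fin 3 → ℝ)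
    (c : Fin k → ℝ) :
    slack (coords u v w, b) (coords x y c) =
      b - (u * x + (v 0 * y 0 + v 1 * y 1 + v 2 * y 2) + ∑ j, w j * c j) := by
  simp only [slack, coords]
  rw [Fin.sum_univ_add, Fin.sum_univ_add]
  simp [Fin.sum_univ_three]

theorem coords_zero_zero (c : Fin k → ℝ) : coords 0 0 c = Fin.append 0 c := by
  rw [coords]
  congr 1
  ext i
  exact Fin.addCases (fun i => by rw [Fin.append_left]; rfl)
    (fun i => by rw [Fin.append_right]; rfl) i

/-- The facet functionals of the iterated pyramid over the product of a segment and a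
tetrahedron. -/
def pyramidFun (k : ℕ) : Fin 2 ⊕ Fin 4 ⊕ Fin k → AffFun (1 + 3 + k) :=
  Sum.elim
    ![(coords (1 / 2) 0 (fun _ => 1 / 2), 1 / 2), (coords (-1 / 2) 0 (fun _ => 1 / 2), 1 / 2)]
    (Sum.elim
      ![(coords 0 ![1 / 4, 1 / 4, 1 / 4] (fun _ => 1 / 4), 1 / 4),
        (coords 0 ![-3 / 4, 1 / 4, 1 / 4] (fun _ => 1 / 4), 1 / 4),
        (coords 0 ![1 / 4, -3 / 4, 1 / 4] (fun _ => 1 / 4), 1 / 4),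
        (coords 0 ![1 / 4, 1 / 4, -3 / 4] (fun _ => 1 / 4), 1 / 4)]
      fun j => (coords 0 0 (Pi.single j (-1)), 0))

theorem slack_pyramidFun (x : ℝ) (y : Fin 3 → ℝ) (c : Fin k → ℝ) (i : Fin 2 ⊕ Fin 4 ⊕ Fin k) :
    slack (pyramidFun k i) (coords x y c) =
      Sum.elim ![(1 - ∑ j, c j - x) / 2, (1 - ∑ j, c j + x) / 2]
        (Sum.elim
          ![(1 - ∑ j, c j - (y 0 + y 1 + y 2)) / 4,
            (1 - ∑ j, c j - (y 0 + y 1 + y 2)) / 4 + y 0,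
            (1 - ∑ j, c j - (y 0 + y 1 + y 2)) / 4 + y 1,
            (1 - ∑ j, c j - (y 0 + y 1 + y 2)) / 4 + y 2]
          c) i := by
  rcases i with i | i | i
  · fin_cases i <;> simp [pyramidFun, slack_coords, ← Finset.mul_sum] <;> ring
  · fin_cases i <;> simp [pyramidFun, slack_coords, ← Finset.mul_sum] <;> ring
  · simp [pyramidFun, slack_coords, Pi.single_apply]

/-- The vertices of the segment. -/
def segmentVertex : Fin 2 → ℝ := ![-1, 1]

/-- The vertices of the tetrahedron. -/
def tetrahedronVertex : Fin 4 → Fin 3 → ℝ := ![![-1, -1, -1], ![1, 0, 0], ![0, 1, 0], ![0, 0, 1]]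

theorem mem_simplexF_one {x : Fin 1 → ℝ} (hx : x ∈ simplexF 1) : -1 ≤ x 0 ∧ x 0 ≤ 1 := by
  have h1 := slack_nonneg_of_mem_convexHull (e := ((fun _ => 1), 1)) (by simp [slack]) x hx
  have h2 := slack_nonneg_of_mem_convexHull (e := ((fun _ => -1), 1)) (by simp [slack]) x hx
  simp [slack] at h1 h2
  constructor <;> linarith

theorem mem_simplexF_three {y : Fin 3 → ℝ} (hy : y ∈ simplexF 3) :
    y 0 + y 1 + y 2 ≤ 1 ∧ ∀ j, y 0 + y 1 + y 2 ≤ 1 + 4 * y j := by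
  constructor
  · have h1 := slack_nonneg_of_mem_convexHull (e := ((fun _ => 1), 1))
      (by simp [slack]; norm_num) y hy
    simp [slack, Fin.sum_univ_three] at h1
    linarith
  · intro j
    have h1 := slack_nonneg_of_mem_convexHull (e := ((fun i => if i = j then -3 else 1), 1))
      (by
        rintro _ (⟨i, rfl⟩ | rfl)
        · by_cases h : i = j <;> simp [slack, Pi.single_apply, h] <;> norm_num
        · fin_cases j <;> simp [slack, Fin.sum_univ_three] <;> norm_num) y hy
    simp [slack, Fin.sum_univ_three] at h1
    fin_cases j <;> simp at h1 ⊢ <;> linarith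

theorem segmentVertex_mem (a : Fin 2) : (fun _ => segmentVertex a) ∈ simplexF 1 := by
  refine subset_convexHull ℝ _ ?_
  fin_cases a
  · exact Or.inr rfl
  · refine Or.inl ⟨0, ?_⟩
    ext i
    rw [Subsingleton.elim i 0]
    simp [segmentVertex]

theorem tetrahedronVertex_mem (b : Fin 4) : tetrahedronVertex b ∈ simplexF 3 := by
  refine subset_convexHull ℝ _ ?_
  have h : b = 0 ∨ ∃ j : Fin 3, b = j.succ := Fin.eq_zero_or_eq_succ b
  rcases h with rfl | ⟨j, rfl⟩
  · refine Or.inr ?_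
    ext i
    fin_cases i <;> simp [tetrahedronVertex]
  · refine Or.inl ⟨j, ?_⟩
    ext i
    fin_cases j <;> fin_cases i <;> simp [tetrahedronVertex]

theorem vertex_mem_pyramid (a : Fin 2) (b : Fin 4) :
    coords (segmentVertex a) (tetrahedronVertex b) 0 ∈ pyrK k (prodP 1 3) :=
  subset_convexHull ℝ _ (Or.inl
    ⟨_, ⟨_, segmentVertex_mem a, _, tetrahedronVertex_mem b, rfl⟩, rfl⟩)

theorem apex_mem_pyramid (j : Fin k) : coords 0 0 (Pi.single j 1) ∈ pyrK k (prodP 1 3) := by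
  rw [coords_zero_zero]
  exact subset_convexHull ℝ _ (Or.inr ⟨j, rfl⟩)

theorem generates_pyramidFun : Generates (pyrK k (prodP 1 3)) (pyramidFun k) := by
  refine ⟨fun i => slack_nonneg_of_mem_convexHull ?_, fun e he => ?_⟩
  · rintro _ (⟨_, ⟨x, hx, y, hy, rfl⟩, rfl⟩ | ⟨j, rfl⟩)
    · have hxy : Fin.append (Fin.append x y) (0 : Fin k → ℝ) = coords (x 0) y 0 := by
        rw [coords]
        congr 2
        ext i
        rw [Subsingleton.elim i 0]
      change 0 ≤ slack _ (Fin.append (Fin.append x y) (0 : Fin k → ℝ))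
      rw [hxy, slack_pyramidFun]
      have h1 := mem_simplexF_one hx
      have h2 := mem_simplexF_three hy
      have h3 := h2.2
      rw [Fin.forall_fin_succ, Fin.forall_fin_two] at h3
      rcases i with i | i | i
      · fin_cases i <;> simp <;> linarith
      · fin_cases i <;> simp at * <;> linarith
      · simp
    · change 0 ≤ slack _ (Fin.append 0 (Pi.single j 1))
      rw [← coords_zero_zero, slack_pyramidFun]
      rcases i with i | i | i
      · fin_cases i <;> simp
      · fin_cases i <;> simp
      · by_cases h : i = j <;> simp [Pi.single_apply, h]
  · obtain ⟨u, v, w, hu⟩ := exists_eq_coords e.1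
    obtain ⟨e, b⟩ := e
    subst hu
    have happ : ∀ j, 0 ≤ b - w j := fun j => by
      simpa [slack_coords, Pi.single_apply] using he _ (apex_mem_pyramid j)
    obtain ⟨a, ha⟩ : ∃ a, u * segmentVertex a = |u| := by
      rcases abs_choice u with h | h
      · exact ⟨1, by simp [segmentVertex, h]⟩
      · exact ⟨0, by simp [segmentVertex, h]⟩
    have hvert := fun i => he _ (vertex_mem_pyramid a i)
    simp only [slack_coords, ha] at hvert
    refine ⟨Sum.elim ![|u| + u, |u| - u] (Sum.elim ![b - |u| + (v 0 + v 1 + v 2), b - |u| - v 0,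
      b - |u| - v 1, b - |u| - v 2] fun j => b - w j), ?_, ?_⟩
    · have h1 := neg_abs_le u
      have h2 := le_abs_self u
      rintro (i | i | i)
      · fin_cases i <;> simp <;> linarith
      · have := hvert i
        fin_cases i <;> simp [tetrahedronVertex] at this ⊢ <;> linarith
      · exact happ i
    · intro z _
      obtain ⟨x, y, c, rfl⟩ := exists_eq_coords z
      simp only [slack_coords, slack_pyramidFun, Fintype.sum_sum_type, Fin.sum_univ_two,
        Fin.sum_univ_four, Sum.elim_inl, Sum.elim_inr, sub_mul, Finset.sum_sub_distrib,
        ← Finset.mul_sum]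
      simp
      ring

theorem pyramid_nonempty_orderIso :
    Nonempty (FaceLattice (pyrK k (prodP 1 3)) ≃o SignBalanced (stdSign 2 4 k)) := by
  refine generates_pyramidFun.nonempty_orderIso (mem_relations.2 fun z _ => ?_)
    (fun c hc => ?_) fun a b ha hb => ?_
  · obtain ⟨x, y, c, rfl⟩ := exists_eq_coords z
    simp only [slack_pyramidFun, Fintype.sum_sum_type, Fin.sum_univ_two, Fin.sum_univ_four,
      stdSign, Sum.elim_inl, Sum.elim_inr]
    simp
    ring
  · rcases c with c | c | c
    · simp [stdSign] at hc
    · simp [stdSign] at hc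
    · refine ⟨_, apex_mem_pyramid c, ?_⟩
      rintro (j | j | j) hj
      · rw [slack_pyramidFun]
        fin_cases j <;> simp
      · rw [slack_pyramidFun]
        fin_cases j <;> simp
      · rw [slack_pyramidFun]
        have : j ≠ c := by simpa using hj
        simp [this]
  · rcases a with a | a | a
    · rcases b with b | b | b
      · norm_num [stdSign] at hb
      · refine ⟨_, vertex_mem_pyramid a b, ?_⟩
        rintro (j | j | j) hja hjb
        · rw [slack_pyramidFun]
          fin_cases j <;> fin_cases a <;> simp [segmentVertex] at hja ⊢
        · rw [slack_pyramidFun]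
          fin_cases j <;> fin_cases b <;> simp [tetrahedronVertex] at hjb ⊢ <;> norm_num
        · rw [slack_pyramidFun]
          simp
      · norm_num [stdSign] at hb
    · norm_num [stdSign] at ha
    · norm_num [stdSign] at ha

end PyramidOverProduct

/-! ### Extension complexity -/

section ExtensionComplexity

variable {M N : ℕ}

theorem IsPolytope.pdim_add_one_le_facetCount {Q : Set (Fin M → ℝ)} (hQ : IsPolytope Q) :
    pdim Q + 1 ≤ facetCount Q := by
  have := hQ.finite_facets
  have := Fintype.ofFinite {F // IsFacetOf F Q}
  obtain ⟨ℓ, hgen, -⟩ := hQ.exists_generates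
  have h := hgen.finrank_relations hQ
  rw [← Nat.card_eq_fintype_card] at h
  have hcard : Nat.card {F // IsFacetOf F Q} = facetCount Q := rfl
  omega

/-- Affine images of simplices have few vertices. -/
theorem IsPolytope.vertexCount_image_le {Q : Set (Fin M → ℝ)} (hQ : IsPolytope Q)
    (hf : (facetCount Q : ℤ) ≤ pdim Q + 1) (π : (Fin M → ℝ) →ᵃ[ℝ] (Fin N → ℝ)) :
    vertexCount (π '' Q) ≤ facetCount Q := by
  have := hQ.finite_facets
  have := Fintype.ofFinite {F // IsFacetOf F Q}
  obtain ⟨ℓ, hgen, -⟩ := hQ.exists_generates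
  have h := hgen.finrank_relations hQ
  rw [← Nat.card_eq_fintype_card] at h
  have hcard : Nat.card {F // IsFacetOf F Q} = facetCount Q := rfl
  have hbot : relations Q ℓ = ⊥ := Submodule.finrank_eq_zero.1 (by omega)
  have := hgen.vertexCount_image_le (π := π) hQ hbot
  rwa [← Nat.card_eq_fintype_card] at this

theorem CombEquiv.facetCount_eq {P : Set (Fin M → ℝ)} {Q : Set (Fin N → ℝ)} (h : CombEquiv P Q)
    (hP : IsPolytope P) (hQ : IsPolytope Q) : facetCount P = facetCount Q := by
  obtain ⟨φ⟩ := combEquiv_iff.1 h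
  rw [hP.facetCount_eq, hQ.facetCount_eq, φ.card_coatoms]

theorem xc_le {P : Set (Fin N → ℝ)} (hP : IsPolytope P) : xc P ≤ facetCount P :=
  Nat.sInf_le ⟨N, P, AffineMap.id ℝ _, hP, image_id P, rfl⟩

theorem exists_facetCount_eq_xc {P : Set (Fin N → ℝ)} (hP : IsPolytope P) :
    ∃ (e : ℕ) (Q : Set (Fin e → ℝ)) (π : (Fin e → ℝ) →ᵃ[ℝ] (Fin N → ℝ)),
      IsPolytope Q ∧ π '' Q = P ∧ facetCount Q = xc P :=
  Nat.sInf_mem (s := {n | ∃ (e : ℕ) (Q : Set (Fin e → ℝ)) (π : (Fin e → ℝ) →ᵃ[ℝ] (Fin N → ℝ)),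
    IsPolytope Q ∧ π '' Q = P ∧ facetCount Q = n})
    ⟨_, N, P, AffineMap.id ℝ _, hP, image_id P, rfl⟩

theorem xc_eq_add_two_iff {d : ℕ} {P : Set (Fin N → ℝ)} (hP : IsPolytope P)
    (hdP : pdim P = d) (hv : d + 2 < vertexCount P) :
    xc P = d + 2 ↔ facetCount P = d + 2 := by
  obtain ⟨e, Q, π, hQ, rfl, hQf⟩ := exists_facetCount_eq_xc hP
  have hle := xc_le hP
  have hdim := pdim_image_le π Q
  have hfacets := hQ.pdim_add_one_le_facetCount
  have hnot : pdim Q + 1 < facetCount Q ∨ d + 2 < facetCount Q := by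
    by_contra! hcon
    have := hQ.vertexCount_image_le hcon.1 π
    omega
  constructor
  · intro hxc
    have hpdim : pdim (π '' Q) = pdim Q := by omega
    have := (combEquiv_image hpdim).facetCount_eq hQ hP
    omega
  · intro hf
    omega

end ExtensionComplexity

theorem xc_d_plus_two_characterization (N d : ℕ) (P : Set (Fin N → ℝ))
    (hP : IsPolytope P) (hdP : pdim P = d) (hv : vertexCount P = d + 4) :
    (xc P = d + 2 ↔ facetCount P = d + 2) ∧
    (facetCount P = d + 2 ↔ CombEquiv P (pyrK (d - 4) (prodP 1 3))) := by
  refine ⟨xc_eq_add_two_iff hP hdP (by omega), fun hf => ?_, fun h => ?_⟩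
  · obtain ⟨φ⟩ := hP.nonempty_orderIso_stdSign hdP hv hf
    obtain ⟨ψ⟩ := pyramid_nonempty_orderIso (k := d - 4)
    exact combEquiv_iff.2 ⟨φ.trans ψ.symm⟩
  · obtain ⟨φ⟩ := combEquiv_iff.1 h
    obtain ⟨ψ⟩ := pyramid_nonempty_orderIso (k := d - 4)
    have hatoms := (φ.trans ψ).card_atoms
    rw [← hP.vertexCount_eq, hv, card_isAtom_stdSign] at hatoms
    have := hP.facetCount_eq_of_orderIso (φ.trans ψ)
    omega

end
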